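/- (Theorem 3.7, constructive part) Consider the uncertain feedforward system (1.1) under assumption (1.2). Let arbitrary constants K₀ > 0 and ω_i > 0 (i = 0,…,n−1) be given, let P_i ∈ ℝ^{i×i} (i = 1,…,n−1) be arbitrary symmetric positive definite matrices, and let p_i ∈ ℝⁱ (i = 1,…,n−1) be arbitrary vectors such that the matrices P_i(A_i + b_i p_i') + (A_i' + p_i b_i')P_i are negative definite; define c_i = −(A_i' + p_i b_i')^{−1}(0,…,0,1)' ∈ ℝⁱ. Then there exist constants r > 0 and K_i > 0, R_i > 0 (i = 1,…,n−1) such that 0 ∈ ℝⁿ is RGAS (properties P1, P2, P3 over all sampling schedules with MASP r, all measurable disturbances, and all closed-loop solutions) for the closed loop of (1.1) with u(t) = k(x(τ_i)) on [τ_i, τ_{i+1}), where k : ℝⁿ → ℝ is defined as follows: if x'Q_l'P_lQ_lx ≥ R_l² for every l = 1,…,n−1 then k(x) = −K₀·sat(ω₀x₁); otherwise k(x) = p_i'Q_ix − K_i c_i'b_i·sat(ω_i(x_{i+1} + c_i'Q_ix)), where i ∈ {1,…,n−1} is the largest integer with x'Q_i'P_iQ_ix < R_i². -/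

import Mathlib

open Matrix MeasureTheory Set Filter

noncomputable section

/-- The `m × m` matrix with ones on the subdiagonal and zeros elsewhere. -/
def matA (m : ℕ) : Matrix (Fin m) (Fin m) ℝ :=
  Matrix.of fun i j => if (i : ℕ) = (j : ℕ) + 1 then 1 else 0

/-- The vector `b = (1,0,…,0)'` as a plain function. -/
def vecbf (m : ℕ) : Fin m → ℝ := fun i => if (i : ℕ) = 0 then 1 else 0

/-- The vector `b = (1,0,…,0)'` in Euclidean space. -/
def vecb (m : ℕ) : EuclideanSpace ℝ (Fin m) := (WithLp.equiv 2 (Fin m → ℝ)).symm (vecbf m)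

/-- View a Euclidean vector as a plain function. -/
def ef {m : ℕ} (x : EuclideanSpace ℝ (Fin m)) : Fin m → ℝ := x

/-- Matrix-vector multiplication on Euclidean space. -/
def mulVecE {m : ℕ} (M : Matrix (Fin m) (Fin m) ℝ) (x : EuclideanSpace ℝ (Fin m)) :
    EuclideanSpace ℝ (Fin m) :=
  (WithLp.equiv 2 (Fin m → ℝ)).symm (M.mulVec (ef x))

/-- Euclidean inner product `x'y`. -/
def ip {m : ℕ} (x y : EuclideanSpace ℝ (Fin m)) : ℝ := ∑ i, x i * y i

/-- Quadratic form `x'Px`. -/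
def qf {m : ℕ} (P : Matrix (Fin m) (Fin m) ℝ) (x : EuclideanSpace ℝ (Fin m)) : ℝ :=
  ip x (mulVecE P x)

/-- The saturation function `sat(s) = s / max(1,|s|)`. -/
def sat (s : ℝ) : ℝ := s / max 1 |s|

/-- A sampling schedule with maximum allowable sampling period `r`. -/
def Sched (r : ℝ) (τ : ℕ → ℝ) : Prop :=
  τ 0 = 0 ∧ (∀ i, 0 < τ (i+1) - τ i) ∧ (∀ i, τ (i+1) - τ i ≤ r) ∧
    Tendsto τ atTop atTop

/-- Truncation keeping the first `m` coordinates (and padding by zeros):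
this represents `x̄_m = (x₁,…,x_m)'`. -/
def truncV {n : ℕ} (m : ℕ) (x : EuclideanSpace ℝ (Fin (n+1))) : EuclideanSpace ℝ (Fin (n+1)) :=
  (WithLp.equiv 2 (Fin (n+1) → ℝ)).symm (fun i => if (i : ℕ) < m then x i else 0)

/-- A (locally absolutely continuous) solution of the closed-loop sampled-data feedforward
system (1.1) with feedback `k`, sampling times `τ` and disturbance `d`:
`ẋ₁ = u`, `ẋᵢ = x_{i-1} + gᵢ(d, x₁,…,x_{i-1}, u)` for `i = 2,…,n`, with
`u = k(x(τ_i))` held constant on each sampling interval. -/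
def FFSol {l n : ℕ}
    (g : Fin (n+1) → EuclideanSpace ℝ (Fin l) → EuclideanSpace ℝ (Fin (n+1)) → ℝ → ℝ)
    (k : EuclideanSpace ℝ (Fin (n+1)) → ℝ) (τ : ℕ → ℝ)
    (d : ℝ → EuclideanSpace ℝ (Fin l))
    (x : ℝ → EuclideanSpace ℝ (Fin (n+1))) : Prop :=
  ∃ x' : ℝ → EuclideanSpace ℝ (Fin (n+1)),
    (∀ T : ℝ, IntervalIntegrable x' volume 0 T) ∧
    (∀ t : ℝ, 0 ≤ t → x t = x 0 + ∫ s in (0:ℝ)..t, x' s) ∧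
    ∀ i : ℕ, ∀ᵐ t ∂(volume.restrict (Ico (τ i) (τ (i+1)))),
      x' t 0 = k (x (τ i)) ∧
      ∀ j : Fin (n+1), (j : ℕ) ≠ 0 →
        x' t j = x t ⟨(j : ℕ) - 1, by have := j.isLt; omega⟩
            + g j (d t) (x t) (k (x (τ i)))

/-- For `j : Fin (n+1)` one has `j + 1 ≤ n + 2`. -/
theorem jle {n : ℕ} (j : Fin (n+1)) : (j : ℕ) + 1 ≤ n + 2 := by have := j.isLt; omega

/-- The projection `Q_m x = (x₁,…,x_m)'` keeping the first `m` coordinates. -/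
def Qtr {N : ℕ} (m : ℕ) (hm : m ≤ N) (x : EuclideanSpace ℝ (Fin N)) :
    EuclideanSpace ℝ (Fin m) :=
  (WithLp.equiv 2 (Fin m → ℝ)).symm (fun j => x (Fin.castLE hm j))

open Classical in
/-- The feedback law (3.19)–(3.21): if `x'Q_l'P_lQ_lx ≥ R_l²` for all `l` then
`k(x) = -K₀ sat(ω₀ x₁)`; otherwise `k(x) = p_i'Q_ix - K_i c_i'b_i sat(ω_i(x_{i+1} + c_i'Q_ix))`
with `i` the largest index such that `x'Q_i'P_iQ_ix < R_i²`.  Here the index `j : Fin (n+1)`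
encodes the paper's index `i = j + 1 ∈ {1,…,n+1}` for the state dimension `n+2`. -/
def kfb (n : ℕ) (K0 : ℝ) (ω : Fin (n+2) → ℝ)
    (P : (j : Fin (n+1)) → Matrix (Fin ((j : ℕ)+1)) (Fin ((j : ℕ)+1)) ℝ)
    (p c : (j : Fin (n+1)) → EuclideanSpace ℝ (Fin ((j : ℕ)+1)))
    (K R : Fin (n+1) → ℝ) (x : EuclideanSpace ℝ (Fin (n+2))) : ℝ :=
  if h : (Finset.univ.filter fun j : Fin (n+1) =>
      qf (P j) (Qtr ((j : ℕ)+1) (jle j) x) < (R j) ^ 2).Nonempty then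
    let j := (Finset.univ.filter fun j : Fin (n+1) =>
      qf (P j) (Qtr ((j : ℕ)+1) (jle j) x) < (R j) ^ 2).max' h
    ip (p j) (Qtr ((j : ℕ)+1) (jle j) x)
      - K j * ip (c j) (vecb ((j : ℕ)+1))
        * sat (ω ⟨(j : ℕ)+1, by have := j.isLt; omega⟩
            * (x ⟨(j : ℕ)+1, by have := j.isLt; omega⟩ + ip (c j) (Qtr ((j : ℕ)+1) (jle j) x)))
  else -K0 * sat (ω 0 * x 0)

lemma ip_eq_inner {m : ℕ} (x y : EuclideanSpace ℝ (Fin m)) : ip x y = inner ℝ x y := by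
  simp [ip, PiLp.inner_apply, mul_comm]

lemma ip_mulVecE {m : ℕ} (M : Matrix (Fin m) (Fin m) ℝ) (x y : EuclideanSpace ℝ (Fin m)) :
    ip x (mulVecE M y) = ef x ⬝ᵥ M *ᵥ ef y := rfl

/-- Matrix-vector multiplication as a continuous linear map. -/
def mulVecL {m : ℕ} (M : Matrix (Fin m) (Fin m) ℝ) :
    EuclideanSpace ℝ (Fin m) →L[ℝ] EuclideanSpace ℝ (Fin m) :=
  LinearMap.toContinuousLinearMap (Matrix.toEuclideanLin M)

lemma mulVecL_apply {m : ℕ} (M : Matrix (Fin m) (Fin m) ℝ) (x : EuclideanSpace ℝ (Fin m)) :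
    mulVecL M x = mulVecE M x := rfl

lemma ef_mulVecL {m : ℕ} (M : Matrix (Fin m) (Fin m) ℝ) (x : EuclideanSpace ℝ (Fin m)) :
    ef (mulVecL M x) = M *ᵥ ef x := rfl

open scoped MatrixOrder in
lemma exists_factor_of_posDef {m : ℕ} {M : Matrix (Fin m) (Fin m) ℝ} (hM : M.PosDef) :
    ∃ T : EuclideanSpace ℝ (Fin m) →L[ℝ] EuclideanSpace ℝ (Fin m),
      (∀ x y, ip x (mulVecE M y) = inner ℝ (T x) (T y)) ∧
      ∃ κ : ℝ, 0 < κ ∧ ∀ x, ‖x‖ ≤ κ * ‖T x‖ := by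
  obtain ⟨B, hB⟩ := CStarAlgebra.nonneg_iff_eq_star_mul_self.mp hM.posSemidef.nonneg
  have hin : ∀ x y, ip x (mulVecE M y) = inner ℝ (mulVecL B x) (mulVecL B y) := by
    intro x y
    rw [← ip_eq_inner, ip_mulVecE]
    change _ = ef (mulVecL B x) ⬝ᵥ ef (mulVecL B y)
    rw [ef_mulVecL, ef_mulVecL, hB, Matrix.star_eq_conjTranspose,
      Matrix.conjTranspose_eq_transpose_of_trivial, ← Matrix.mulVec_mulVec,
      Matrix.dotProduct_mulVec, Matrix.vecMul_transpose]
  refine ⟨mulVecL B, hin, ?_⟩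
  have hker : LinearMap.ker (mulVecL B).toLinearMap = ⊥ := by
    rw [LinearMap.ker_eq_bot']
    intro x hx
    by_contra hne
    have hx' : mulVecL B x = 0 := hx
    have h1 := hin x x
    rw [hx', inner_zero_left, ip_mulVecE] at h1
    have h2 := hM.dotProduct_mulVec_pos (x := ef x)
      (fun h => hne (by ext i; exact congrFun h i))
    rw [star_trivial] at h2
    linarith
  obtain ⟨K, hK0, hK⟩ := LinearMap.exists_antilipschitzWith _ hker
  refine ⟨K, by exact_mod_cast hK0, fun x => ?_⟩
  have := hK.le_mul_dist x 0
  simpa using this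

/-- A quadratic Lyapunov matrix makes the explicit Euler step contracting for small steps. -/
lemma euler_step_contraction {m : ℕ} {P F : Matrix (Fin m) (Fin m) ℝ}
    (hneg : (-(P * F + Fᵀ * P)).PosDef)
    {T : EuclideanSpace ℝ (Fin m) →L[ℝ] EuclideanSpace ℝ (Fin m)}
    (hT : ∀ x y, ip x (mulVecE P y) = inner ℝ (T x) (T y))
    {κ : ℝ} (hκ0 : 0 < κ) (hκ : ∀ x, ‖x‖ ≤ κ * ‖T x‖) :
    ∃ μ ρ : ℝ, 0 < μ ∧ 0 < ρ ∧ ρ * μ ≤ 1 ∧ ∀ h, 0 ≤ h → h ≤ ρ → ∀ x,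
      ‖T (x + h • mulVecL F x)‖ ≤ (1 - μ * h) * ‖T x‖ := by
  obtain ⟨S, hS, σ, hσ0, hσ⟩ := exists_factor_of_posDef hneg
  have hcross : ∀ x, 2 * inner ℝ (T x) (T (mulVecL F x)) = -‖S x‖ ^ 2 := by
    intro x
    have h1 := hS x x
    rw [real_inner_self_eq_norm_sq] at h1
    have h2 := hT x (mulVecL F x)
    have h3 := hT (mulVecL F x) x
    rw [real_inner_comm] at h3
    rw [ip_mulVecE, ef_mulVecL] at h2
    rw [ip_mulVecE, ef_mulVecL] at h3
    rw [ip_mulVecE, Matrix.neg_mulVec, Matrix.add_mulVec, dotProduct_neg, dotProduct_add,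
      ← Matrix.mulVec_mulVec, ← Matrix.mulVec_mulVec, Matrix.dotProduct_mulVec _ Fᵀ,
      Matrix.vecMul_transpose] at h1
    linarith
  set τ := ‖T‖ + 1 with hτ
  have hτ0 : 0 < τ := by positivity
  have hTx : ∀ x, ‖T x‖ ≤ τ * ‖x‖ := fun x =>
    (T.le_opNorm x).trans (by gcongr; linarith)
  set l := (1 / (σ * τ)) ^ 2 with hl
  have hl0 : 0 < l := by positivity
  have hSl : ∀ x, l * ‖T x‖ ^ 2 ≤ ‖S x‖ ^ 2 := by
    intro x
    rw [hl, ← mul_pow]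
    gcongr
    rw [div_mul_eq_mul_div, one_mul, div_le_iff₀ (by positivity)]
    calc ‖T x‖ ≤ τ * ‖x‖ := hTx x
      _ ≤ τ * (σ * ‖S x‖) := by gcongr; exact hσ x
      _ = _ := by ring
  set q := τ * ‖mulVecL F‖ * κ + 1 with hq
  have hq0 : 0 < q := by positivity
  have hTF : ∀ x, ‖T (mulVecL F x)‖ ≤ q * ‖T x‖ := by
    intro x
    calc ‖T (mulVecL F x)‖ ≤ τ * ‖mulVecL F x‖ := hTx _
      _ ≤ τ * (‖mulVecL F‖ * ‖x‖) := by gcongr; exact (mulVecL F).le_opNorm x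
      _ ≤ τ * (‖mulVecL F‖ * (κ * ‖T x‖)) := by gcongr; exact hκ x
      _ ≤ _ := by rw [hq]; nlinarith [norm_nonneg (T x)]
  refine ⟨l / 4, min (l / (2 * q ^ 2)) (4 / l), by positivity, by positivity, ?_, ?_⟩
  · calc _ ≤ 4 / l * (l / 4) := by gcongr; exact min_le_right _ _
      _ = 1 := by field_simp
  · intro h h0 hρ x
    have hh1 : h * (2 * q ^ 2) ≤ l :=
      (le_div_iff₀ (by positivity)).1 (hρ.trans (min_le_left _ _))
    have hh2 : h * l ≤ 4 := (le_div_iff₀ (by positivity)).1 (hρ.trans (min_le_right _ _))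
    refine le_of_sq_le_sq ?_ (mul_nonneg (by linarith) (norm_nonneg _))
    rw [map_add, map_smul, norm_add_sq_real, inner_smul_right, norm_smul, Real.norm_eq_abs,
      abs_of_nonneg h0]
    have e1 := hcross x
    have e2 := hSl x
    have e3 : ‖T (mulVecL F x)‖ ^ 2 ≤ q ^ 2 * ‖T x‖ ^ 2 := by
      rw [← mul_pow]; gcongr; exact hTF x
    have e4 : 0 ≤ ‖T x‖ ^ 2 := by positivity
    have e5 : (h * ‖T (mulVecL F x)‖) ^ 2 ≤ h * (l / 2) * ‖T x‖ ^ 2 := by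
      calc (h * ‖T (mulVecL F x)‖) ^ 2 = h * (h * ‖T (mulVecL F x)‖ ^ 2) := by ring
        _ ≤ h * (h * (q ^ 2 * ‖T x‖ ^ 2)) := by gcongr
        _ = h * (h * (2 * q ^ 2)) * (‖T x‖ ^ 2 / 2) := by ring
        _ ≤ h * l * (‖T x‖ ^ 2 / 2) := by gcongr
        _ = _ := by ring
    have e6 : 2 * (h * inner ℝ (T x) (T (mulVecL F x))) ≤ -(h * l * ‖T x‖ ^ 2) := by
      have : h * (2 * inner ℝ (T x) (T (mulVecL F x))) ≤ h * (-(l * ‖T x‖ ^ 2)) := by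
        gcongr; linarith
      linarith
    have e7 : 0 ≤ (l / 4 * h) ^ 2 * ‖T x‖ ^ 2 := by positivity
    nlinarith

lemma isUnit_det_of_lyapunov {m : ℕ} {P F : Matrix (Fin m) (Fin m) ℝ}
    (hneg : (-(P * F + Fᵀ * P)).PosDef) : IsUnit F.det := by
  rw [isUnit_iff_ne_zero]
  intro h0
  obtain ⟨v, hv, hFv⟩ := Matrix.exists_mulVec_eq_zero_iff.2 h0
  have := hneg.dotProduct_mulVec_pos hv
  rw [star_trivial, Matrix.neg_mulVec, Matrix.add_mulVec, dotProduct_neg, dotProduct_add,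
      ← Matrix.mulVec_mulVec, ← Matrix.mulVec_mulVec, Matrix.dotProduct_mulVec _ Fᵀ,
      Matrix.vecMul_transpose, hFv] at this
  simp at this

lemma mulVecE_closedLoop_apply {m : ℕ} (p x : EuclideanSpace ℝ (Fin (m + 1))) (i : Fin (m + 1)) :
    mulVecE (matA (m + 1) + vecMulVec (vecbf (m + 1)) (ef p)) x i =
      if (i : ℕ) = 0 then ip p x else x ⟨(i : ℕ) - 1, by have := i.isLt; omega⟩ := by
  change ((matA (m + 1) + vecMulVec (vecbf (m + 1)) (ef p)) *ᵥ ef x) i = _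
  rw [Matrix.add_mulVec, Pi.add_apply, Matrix.vecMulVec_mulVec]
  have hA : (matA (m + 1) *ᵥ ef x) i =
      if (i : ℕ) = 0 then 0 else x ⟨(i : ℕ) - 1, by have := i.isLt; omega⟩ := by
    simp only [Matrix.mulVec, dotProduct, matA, Matrix.of_apply, ite_mul, one_mul, zero_mul]
    split_ifs with h
    · refine Finset.sum_eq_zero fun j _ => if_neg (by omega)
    · rw [Finset.sum_eq_single (⟨(i : ℕ) - 1, by have := i.isLt; omega⟩ : Fin (m + 1))]
      · rw [if_pos (by simp; omega)]; rfl
      · intro j _ hj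
        exact if_neg fun h' => hj (Fin.ext (by simp; omega))
      · simp
  rw [hA]
  by_cases h : (i : ℕ) = 0
  · simp [h, vecbf, ip, ef, dotProduct]
  · simp [h, vecbf]

lemma ip_c_closedLoop {m : ℕ} {F : Matrix (Fin (m + 1)) (Fin (m + 1)) ℝ} (hF : IsUnit F.det)
    {c : EuclideanSpace ℝ (Fin (m + 1))}
    (hc : ef c = -(Fᵀ⁻¹ *ᵥ Pi.single (Fin.last m) 1)) (x : EuclideanSpace ℝ (Fin (m + 1))) :
    ip c (mulVecE F x) = -x (Fin.last m) := by
  have h1 : Fᵀ *ᵥ ef c = -Pi.single (Fin.last m) 1 := by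
    rw [hc, Matrix.mulVec_neg, Matrix.mulVec_mulVec, Matrix.mul_nonsing_inv _ (by
      rwa [Matrix.det_transpose]), Matrix.one_mulVec]
  rw [ip_mulVecE, Matrix.dotProduct_mulVec, ← Matrix.mulVec_transpose, h1]
  simp [ef]

lemma ip_c_vecb_ne_zero {m : ℕ} {p c : EuclideanSpace ℝ (Fin (m + 1))}
    (hc : ∀ x, ip c (mulVecE (matA (m + 1) + vecMulVec (vecbf (m + 1)) (ef p)) x) =
      -x (Fin.last m)) :
    ip c (vecb (m + 1)) ≠ 0 := by
  intro h0
  have h1 := hc (EuclideanSpace.single (Fin.last m) 1)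
  have h2 : mulVecE (matA (m + 1) + vecMulVec (vecbf (m + 1)) (ef p))
      (EuclideanSpace.single (Fin.last m) 1) =
      ip p (EuclideanSpace.single (Fin.last m) 1) • vecb (m + 1) := by
    ext i
    rw [mulVecE_closedLoop_apply]
    by_cases h : (i : ℕ) = 0
    · simp [h, vecb, vecbf]
    · have : (⟨(i : ℕ) - 1, by have := i.isLt; omega⟩ : Fin (m + 1)) ≠ Fin.last m := by
        intro h'
        have := congrArg Fin.val h'
        have := i.isLt
        simp at *
        omega
      simp [h, vecb, vecbf, this]
  rw [h2, ip_eq_inner, inner_smul_right, ← ip_eq_inner, h0] at h1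
  simp at h1

/-- The right-hand side of the `j`-th equation of the feedforward system along a trajectory `x`
with disturbance `d` and input `v`. -/
def ffRhs {l n : ℕ}
    (g : Fin (n+1) → EuclideanSpace ℝ (Fin l) → EuclideanSpace ℝ (Fin (n+1)) → ℝ → ℝ)
    (d : ℝ → EuclideanSpace ℝ (Fin l)) (x : ℝ → EuclideanSpace ℝ (Fin (n+1))) (v : ℝ → ℝ)
    (j : Fin (n+1)) (s : ℝ) : ℝ :=
  if (j : ℕ) = 0 then v s
  else x s ⟨(j : ℕ) - 1, by have := j.isLt; omega⟩ + g j (d s) (x s) (v s)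

/-- The mean value inequality satisfied by absolutely continuous trajectories of the
feedforward system. -/
def FFMeanValue {l n : ℕ}
    (g : Fin (n+1) → EuclideanSpace ℝ (Fin l) → EuclideanSpace ℝ (Fin (n+1)) → ℝ → ℝ)
    (d : ℝ → EuclideanSpace ℝ (Fin l)) (x : ℝ → EuclideanSpace ℝ (Fin (n+1))) (v : ℝ → ℝ) :
    Prop :=
  ∀ (j : Fin (n+1)) (a t : ℝ), 0 ≤ a → a ≤ t → ∀ w M : ℝ,
    (∀ s ∈ Ico a t, |ffRhs g d x v j s - w| ≤ M) → |x t j - x a j - (t - a) * w| ≤ M * (t - a)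

/-- Quadratic growth of the nonlinearities, uniformly on bounded sets. -/
def QuadraticGrowth {l n : ℕ} (D : Set (EuclideanSpace ℝ (Fin l)))
    (g : Fin (n+1) → EuclideanSpace ℝ (Fin l) → EuclideanSpace ℝ (Fin (n+1)) → ℝ → ℝ) : Prop :=
  ∀ B : ℝ, 0 ≤ B → ∃ G : ℝ, 0 ≤ G ∧ ∀ j : Fin (n+1), (j : ℕ) ≠ 0 → ∀ d ∈ D,
    ∀ (x : EuclideanSpace ℝ (Fin (n+1))) (u S : ℝ), 0 ≤ S → S ≤ B → |u| ≤ S →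
      (∀ i : Fin (n+1), (i : ℕ) < j → |x i| ≤ S) → |g j d x u| ≤ G * S ^ 2

lemma norm_le_of_abs_le {m : ℕ} {x : EuclideanSpace ℝ (Fin m)} {S : ℝ} (hS : 0 ≤ S)
    (h : ∀ i, |x i| ≤ S) : ‖x‖ ≤ m * S := by
  refine le_of_sq_le_sq ?_ (by positivity)
  rw [EuclideanSpace.norm_sq_eq]
  refine (Finset.sum_le_sum fun i _ => pow_le_pow_left₀ (norm_nonneg _) (h i) 2).trans ?_
  simp only [Finset.sum_const, Finset.card_univ, Fintype.card_fin, nsmul_eq_mul, mul_pow]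
  gcongr
  exact_mod_cast Nat.le_self_pow two_ne_zero m

lemma norm_truncV_le {n m : ℕ} {x : EuclideanSpace ℝ (Fin (n+1))} {S : ℝ} (hS : 0 ≤ S)
    (h : ∀ i : Fin (n+1), (i : ℕ) < m → |x i| ≤ S) : ‖truncV m x‖ ≤ (n + 1) * S := by
  refine (norm_le_of_abs_le hS fun i => ?_).trans_eq (by push_cast; rfl)
  have hi : truncV m x i = if (i : ℕ) < m then x i else 0 := rfl
  rw [hi]
  split_ifs with h'
  · exact h i h'
  · simpa using hS

lemma quadraticGrowth_of_bound {l n : ℕ} {D : Set (EuclideanSpace ℝ (Fin l))}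
    {g : Fin (n+1) → EuclideanSpace ℝ (Fin l) → EuclideanSpace ℝ (Fin (n+1)) → ℝ → ℝ}
    {L : ℝ → ℝ} (hLmono : MonotoneOn L (Ici 0)) (hLnn : ∀ s : ℝ, 0 ≤ s → 0 ≤ L s)
    (hgrowth : ∀ j : Fin (n+1), (j : ℕ) ≠ 0 → ∀ d ∈ D,
      ∀ x : EuclideanSpace ℝ (Fin (n+1)), ∀ u : ℝ,
      |g j d x u| ≤
        L (Real.sqrt (‖truncV (j : ℕ) x‖ ^ 2 + u ^ 2)) * ‖truncV (j : ℕ) x‖ ^ 2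
          + L (Real.sqrt (‖truncV (j : ℕ) x‖ ^ 2 + u ^ 2)) * ‖truncV (j : ℕ) x‖ * |u|) :
    QuadraticGrowth D g := by
  intro B hB
  set Λ := L (Real.sqrt (((n + 1) * B) ^ 2 + B ^ 2)) with hΛ
  have hΛ0 : 0 ≤ Λ := hLnn _ (Real.sqrt_nonneg _)
  refine ⟨Λ * (n + 1) ^ 2 + Λ * (n + 1), by positivity, ?_⟩
  intro j hj d hd x u S hS0 hSB hu hx
  have ht := norm_truncV_le hS0 hx
  have ht0 := norm_nonneg (truncV (j : ℕ) x)
  have hLΛ : L (Real.sqrt (‖truncV (j : ℕ) x‖ ^ 2 + u ^ 2)) ≤ Λ := by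
    refine hLmono (Real.sqrt_nonneg _) (Real.sqrt_nonneg _) (Real.sqrt_le_sqrt ?_)
    rw [← sq_abs u]
    have : ‖truncV (j : ℕ) x‖ ≤ (n + 1) * B := ht.trans (by gcongr)
    gcongr
    exact hu.trans hSB
  calc |g j d x u| ≤ _ := hgrowth j hj d hd x u
    _ ≤ Λ * ((n + 1) * S) ^ 2 + Λ * ((n + 1) * S) * S := by gcongr
    _ = _ := by ring

section Trajectory

variable {l n : ℕ} {D : Set (EuclideanSpace ℝ (Fin l))}
  {g : Fin (n+1) → EuclideanSpace ℝ (Fin l) → EuclideanSpace ℝ (Fin (n+1)) → ℝ → ℝ}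

/-- The first `k` coordinates of a trajectory grow at most linearly with the size of the data on
bounded time intervals, by the triangular structure. -/
lemma QuadraticGrowth.bound_on_interval (hg : QuadraticGrowth D g) (k : ℕ) {T B : ℝ}
    (hT : 0 ≤ T) (hB : 0 ≤ B) :
    ∃ C : ℝ, 1 ≤ C ∧ ∀ (d : ℝ → EuclideanSpace ℝ (Fin l))
      (x : ℝ → EuclideanSpace ℝ (Fin (n+1))) (v : ℝ → ℝ), (∀ t, d t ∈ D) →
      FFMeanValue g d x v → ∀ a b S : ℝ, 0 ≤ a → b ≤ a + T → 0 ≤ S → S ≤ B →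
      (∀ s ∈ Ico a b, |v s| ≤ S) → (∀ i : Fin (n+1), (i : ℕ) < k → |x a i| ≤ S) →
      ∀ t ∈ Icc a b, ∀ i : Fin (n+1), (i : ℕ) < k → |x t i| ≤ C * S := by
  induction k with
  | zero => exact ⟨1, le_rfl, fun _ _ _ _ _ _ _ _ _ _ _ _ _ _ _ _ _ hi => absurd hi (by omega)⟩
  | succ k ih =>
    obtain ⟨C, hC1, hC⟩ := ih
    have hC0 : 0 ≤ C := by linarith
    obtain ⟨G, hG0, hG⟩ := hg (C * B) (by positivity)
    refine ⟨C + T * (C + G * C ^ 2 * B), ?_, ?_⟩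
    · have : 0 ≤ T * (C + G * C ^ 2 * B) := by positivity
      linarith
    intro d x v hd hx a b S ha hb hS hSB hv h0 t ht i hi
    have hprev := hC d x v hd hx a b S ha hb hS hSB hv (fun i hi => h0 i (by omega))
    rcases Nat.lt_or_eq_of_le (Nat.lt_succ_iff.1 hi) with hi' | hi'
    · refine (hprev t ht i hi').trans ?_
      gcongr
      have : 0 ≤ T * (C + G * C ^ 2 * B) := by positivity
      linarith
    · have hS2 : S ≤ C * S := le_mul_of_one_le_left hS hC1
      have hM : ∀ s ∈ Ico a t, |ffRhs g d x v i s - 0| ≤ (C + G * C ^ 2 * B) * S := by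
        intro s hs
        have hs' : s ∈ Ico a b := ⟨hs.1, hs.2.trans_le ht.2⟩
        have hGB : 0 ≤ G * C ^ 2 * B * S := by positivity
        rw [sub_zero, ffRhs]
        split_ifs with hi0
        · refine (hv s hs').trans ?_
          linarith
        · have h1 := hprev s ⟨hs'.1, hs'.2.le⟩ ⟨(i : ℕ) - 1, by have := i.isLt; omega⟩
            (by simp; omega)
          have h2 := hG i hi0 (d s) (hd s) (x s) (v s) (C * S) (by positivity) (by gcongr)
            ((hv s hs').trans hS2)
            (fun m hm => hprev s ⟨hs'.1, hs'.2.le⟩ m (by omega))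
          calc _ ≤ _ := abs_add_le _ _
            _ ≤ C * S + G * (C * S) ^ 2 := add_le_add h1 h2
            _ = C * S + G * C ^ 2 * S * S := by ring
            _ ≤ C * S + G * C ^ 2 * B * S := by gcongr
            _ = _ := by ring
      have h1 := hx i a t ha ht.1 0 _ hM
      have h2 := h0 i hi
      have hta : t - a ≤ T := by linarith [ht.2]
      have h3 : (C + G * C ^ 2 * B) * S * (t - a) ≤ (C + G * C ^ 2 * B) * S * T := by
        gcongr
      rw [mul_zero, sub_zero] at h1
      have h4 : |x t i| ≤ |x t i - x a i| + |x a i| := by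
        simpa using abs_add_le (x t i - x a i) (x a i)
      nlinarith

/-- First-order expansion of the coordinates of a trajectory over a short time interval on which
the input is constant. -/
lemma QuadraticGrowth.step_expansion (hg : QuadraticGrowth D g) (k : ℕ) {B : ℝ} (hB : 0 ≤ B) :
    ∃ C : ℝ, 1 ≤ C ∧ ∀ (d : ℝ → EuclideanSpace ℝ (Fin l))
      (x : ℝ → EuclideanSpace ℝ (Fin (n+1))) (v : ℝ → ℝ), (∀ t, d t ∈ D) →
      FFMeanValue g d x v → ∀ a b S : ℝ, 0 ≤ a → a ≤ b → b ≤ a + 1 → 0 ≤ S → S ≤ B →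
      (∀ s ∈ Ico a b, |v s| ≤ S) → (∀ i : Fin (n+1), (i : ℕ) < k → |x a i| ≤ S) →
      ∀ i : Fin (n+1), (hi0 : (i : ℕ) ≠ 0) → (i : ℕ) ≤ k →
        |x b i - x a i - (b - a) * x a ⟨(i : ℕ) - 1, by have := i.isLt; omega⟩| ≤
          (b - a) * (C * ((b - a) * S + S ^ 2)) := by
  obtain ⟨C, hC1, hC⟩ := hg.bound_on_interval k (T := 1) zero_le_one hB
  have hC0 : 0 ≤ C := by linarith
  obtain ⟨G, hG0, hG⟩ := hg (C * B) (by positivity)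
  have hGC : 0 ≤ G * C ^ 2 := by positivity
  refine ⟨C + G * C ^ 2 * (B + 1), by nlinarith [mul_nonneg hGC hB], ?_⟩
  intro d x v hd hx a b S ha hab hb hS hSB hv h0
  have hprev := hC d x v hd hx a b S ha hb hS hSB hv h0
  have hS2 : S ≤ C * S := le_mul_of_one_le_left hS hC1
  have hgS : ∀ s ∈ Ico a b, ∀ i : Fin (n+1), (i : ℕ) ≠ 0 → (i : ℕ) ≤ k →
      |g i (d s) (x s) (v s)| ≤ G * C ^ 2 * S ^ 2 := by
    intro s hs i hi0 hik
    refine (hG i hi0 (d s) (hd s) (x s) (v s) (C * S) (by positivity) (by gcongr)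
      ((hv s hs).trans hS2) (fun m hm => hprev s ⟨hs.1, hs.2.le⟩ m (by omega))).trans_eq (by ring)
  have hvar : ∀ t ∈ Icc a b, ∀ i : Fin (n+1), (i : ℕ) < k →
      |x t i - x a i| ≤ (C + G * C ^ 2 * B) * S * (t - a) := by
    intro t ht i hik
    have := hx i a t ha ht.1 0 ((C + G * C ^ 2 * B) * S) (by
      intro s hs
      have hs' : s ∈ Ico a b := ⟨hs.1, hs.2.trans_le ht.2⟩
      rw [sub_zero, ffRhs]
      split_ifs with hi0
      · refine (hv s hs').trans ?_
        have : 0 ≤ G * C ^ 2 * B * S := by positivity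
        linarith
      · calc _ ≤ _ := abs_add_le _ _
          _ ≤ C * S + G * C ^ 2 * S ^ 2 := by
            refine add_le_add (hprev s ⟨hs'.1, hs'.2.le⟩ _ ?_) (hgS s hs' i hi0 hik.le)
            simp only; omega
          _ = C * S + G * C ^ 2 * S * S := by ring
          _ ≤ C * S + G * C ^ 2 * B * S := by gcongr
          _ = _ := by ring)
    simpa using this
  intro i hi0 hik
  have := hx i a b ha hab (x a ⟨(i : ℕ) - 1, by have := i.isLt; omega⟩)
    ((C + G * C ^ 2 * B) * S * (b - a) + G * C ^ 2 * S ^ 2) (by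
      intro s hs
      rw [ffRhs, if_neg hi0, add_sub_right_comm]
      refine (abs_add_le _ _).trans (add_le_add ?_ (hgS s hs i hi0 hik))
      refine (hvar s ⟨hs.1, hs.2.le⟩ _ (by simp only; omega)).trans ?_
      have := hs.2.le
      gcongr)
  refine this.trans ?_
  have hh : 0 ≤ b - a := by linarith
  have h1 : 0 ≤ (b - a) * S := by positivity
  have e : (C + G * C ^ 2 * B) * S * (b - a) + G * C ^ 2 * S ^ 2 ≤
      (C + G * C ^ 2 * (B + 1)) * ((b - a) * S + S ^ 2) := by
    nlinarith [mul_nonneg hGC h1, mul_nonneg (mul_nonneg hGC hB) (sq_nonneg S),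
      mul_nonneg hC0 (sq_nonneg S)]
  calc _ ≤ ((C + G * C ^ 2 * (B + 1)) * ((b - a) * S + S ^ 2)) * (b - a) := by gcongr
    _ = _ := by ring

end Trajectory

section Schedule

variable {r : ℝ} {τ : ℕ → ℝ}

lemma Sched.strictMono (h : Sched r τ) : StrictMono τ :=
  strictMono_nat_of_lt_succ fun i => by linarith [h.2.1 i]

lemma Sched.nonneg (h : Sched r τ) (i : ℕ) : 0 ≤ τ i :=
  h.1 ▸ h.strictMono.monotone (Nat.zero_le i)

/-- The first sampling time after `T` is at most `T + r`. -/
lemma Sched.exists_first_ge (h : Sched r τ) {T : ℝ} (hr : 0 ≤ r) (hT : 0 ≤ T) :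
    ∃ i, T ≤ τ i ∧ τ i ≤ T + r ∧ ∀ k, T ≤ τ k → i ≤ k := by
  have hex : ∃ i, T ≤ τ i := (h.2.2.2.eventually_ge_atTop T).exists
  classical
  refine ⟨Nat.find hex, Nat.find_spec hex, ?_, fun k hk => Nat.find_min' hex hk⟩
  rcases Nat.eq_zero_or_eq_succ_pred (Nat.find hex) with h0 | h0
  · rw [h0, h.1]; linarith
  · have := Nat.find_min hex (m := (Nat.find hex).pred) (by omega)
    have h2 := h.2.2.1 (Nat.find hex).pred
    rw [← Nat.succ_eq_add_one, ← h0] at h2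
    linarith [not_le.1 this]

lemma Sched.exists_mem_Ico (h : Sched r τ) {s : ℝ} (hs : 0 ≤ s) :
    ∃ i, s ∈ Ico (τ i) (τ (i + 1)) := by
  have hex : ∃ i, s < τ i := (h.2.2.2.eventually_gt_atTop s).exists
  classical
  have h0 : Nat.find hex ≠ 0 := by
    intro h0
    have := Nat.find_spec hex
    rw [h0, h.1] at this
    linarith
  refine ⟨Nat.find hex - 1, not_lt.1 (Nat.find_min hex (by omega)), ?_⟩
  rw [Nat.sub_add_cancel (by omega)]
  exact Nat.find_spec hex

lemma Sched.eq_of_mem_Ico (h : Sched r τ) {s : ℝ} {i j : ℕ} (hi : s ∈ Ico (τ i) (τ (i + 1)))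
    (hj : s ∈ Ico (τ j) (τ (j + 1))) : i = j := by
  have h1 := h.strictMono.lt_iff_lt.1 (hi.1.trans_lt hj.2)
  have h2 := h.strictMono.lt_iff_lt.1 (hj.1.trans_lt hi.2)
  omega

end Schedule

/-- The piecewise constant input generated along a closed-loop solution, and the mean value
inequality for that solution. -/
lemma FFSol.exists_input {l n : ℕ} {r : ℝ} {τ : ℕ → ℝ}
    {g : Fin (n+1) → EuclideanSpace ℝ (Fin l) → EuclideanSpace ℝ (Fin (n+1)) → ℝ → ℝ}
    {k : EuclideanSpace ℝ (Fin (n+1)) → ℝ} {d : ℝ → EuclideanSpace ℝ (Fin l)}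
    {x : ℝ → EuclideanSpace ℝ (Fin (n+1))} (hτ : Sched r τ) (hx : FFSol g k τ d x) :
    ∃ v : ℝ → ℝ, (∀ i, ∀ s ∈ Ico (τ i) (τ (i + 1)), v s = k (x (τ i))) ∧
      FFMeanValue g d x v := by
  obtain ⟨x', hint, hxt, hae⟩ := hx
  choose! ι hι using fun (s : ℝ) (hs : 0 ≤ s) => hτ.exists_mem_Ico hs
  have hv : ∀ i, ∀ s ∈ Ico (τ i) (τ (i + 1)), k (x (τ (ι s))) = k (x (τ i)) := by
    intro i s hs
    rw [hτ.eq_of_mem_Ico (hι s ((hτ.nonneg i).trans hs.1)) hs]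
  refine ⟨fun s => k (x (τ (ι s))), hv, ?_⟩
  intro j a t ha hat w M hM
  have hae' : ∀ᵐ s, 0 ≤ s → x' s j = ffRhs g d x (fun s => k (x (τ (ι s)))) j s := by
    have h1 : ∀ᵐ s, ∀ i, s ∈ Ico (τ i) (τ (i + 1)) →
        x' s j = ffRhs g d x (fun s => k (x (τ (ι s)))) j s := by
      rw [ae_all_iff]
      intro i
      filter_upwards [(ae_restrict_iff' measurableSet_Ico).1 (hae i)] with s hs hsi
      obtain ⟨h1, h2⟩ := hs hsi
      rw [ffRhs]
      split_ifs with hj0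
      · obtain rfl : j = 0 := Fin.ext hj0
        rw [hv i s hsi, ← h1]
      · rw [h2 j hj0, hv i s hsi]
    filter_upwards [h1] with s hs h0
    exact hs _ (hι s h0)
  have hj : ∀ T, IntervalIntegrable (fun s => x' s j) volume 0 T := fun T =>
    ⟨(EuclideanSpace.proj (𝕜 := ℝ) j).integrable_comp (hint T).1,
      (EuclideanSpace.proj (𝕜 := ℝ) j).integrable_comp (hint T).2⟩
  have hcomp : ∀ T, 0 ≤ T → x T j = x 0 j + ∫ s in (0:ℝ)..T, x' s j := by
    intro T hT
    have h1 := (EuclideanSpace.proj (𝕜 := ℝ) j).intervalIntegral_comp_comm (hint T)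
    have h2 := congrArg (EuclideanSpace.proj (𝕜 := ℝ) j) (hxt T hT)
    rw [map_add, ← h1] at h2
    exact h2
  have hdiff : x t j - x a j - (t - a) * w = ∫ s in a..t, (x' s j - w) := by
    have hat' : IntervalIntegrable (fun s => x' s j) volume a t := (hj a).symm.trans (hj t)
    rw [intervalIntegral.integral_sub hat' intervalIntegrable_const,
      intervalIntegral.integral_const, smul_eq_mul, hcomp t (ha.trans hat), hcomp a ha,
      ← intervalIntegral.integral_interval_sub_left (hj t) (hj a)]
    ring
  rw [hdiff, ← abs_of_nonneg (sub_nonneg.2 hat), ← Real.norm_eq_abs]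
  refine intervalIntegral.norm_integral_le_of_norm_le_const_ae ?_
  have hne : ∀ᵐ s : ℝ, s ≠ t := by simp [ae_iff]
  filter_upwards [hae', hne] with s hs hst hmem
  rw [uIoc_of_le hat] at hmem
  rw [hs (ha.trans hmem.1.le), Real.norm_eq_abs]
  exact hM s ⟨hmem.1.le, lt_of_le_of_ne hmem.2 hst⟩

section Mode

variable {n l : ℕ}

/-- The square root of the quadratic form `x'Q_i'P_iQ_ix`. -/
def lyapV (j : Fin (n+1)) (P : Matrix (Fin ((j : ℕ)+1)) (Fin ((j : ℕ)+1)) ℝ)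
    (x : EuclideanSpace ℝ (Fin (n+2))) : ℝ :=
  Real.sqrt (qf P (Qtr ((j : ℕ)+1) (jle j) x))

/-- The index of the first coordinate not controlled by the linear feedback of mode `j`. -/
def nextIdx (j : Fin (n+1)) : Fin (n+2) := ⟨(j : ℕ)+1, by have := j.isLt; omega⟩

/-- The saturated variable `x_{i+1} + c_i'Q_ix`. -/
def outY (j : Fin (n+1)) (c : EuclideanSpace ℝ (Fin ((j : ℕ)+1)))
    (x : EuclideanSpace ℝ (Fin (n+2))) : ℝ :=
  x (nextIdx j) + ip c (Qtr ((j : ℕ)+1) (jle j) x)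

lemma Qtr_apply {N m : ℕ} (hm : m ≤ N) (x : EuclideanSpace ℝ (Fin N)) (i : Fin m) :
    Qtr m hm x i = x (Fin.castLE hm i) := rfl

lemma abs_ip_le {m : ℕ} (x y : EuclideanSpace ℝ (Fin m)) : |ip x y| ≤ ‖x‖ * ‖y‖ := by
  rw [ip_eq_inner]; exact abs_real_inner_le_norm x y

lemma lyapV_nonneg (j : Fin (n+1)) (P : Matrix (Fin ((j : ℕ)+1)) (Fin ((j : ℕ)+1)) ℝ)
    (x : EuclideanSpace ℝ (Fin (n+2))) : 0 ≤ lyapV j P x := Real.sqrt_nonneg _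

lemma lyapV_eq_norm {j : Fin (n+1)} {P : Matrix (Fin ((j : ℕ)+1)) (Fin ((j : ℕ)+1)) ℝ}
    {T : EuclideanSpace ℝ (Fin ((j : ℕ)+1)) →L[ℝ] EuclideanSpace ℝ (Fin ((j : ℕ)+1))}
    (hT : ∀ x y, ip x (mulVecE P y) = inner ℝ (T x) (T y))
    (x : EuclideanSpace ℝ (Fin (n+2))) :
    lyapV j P x = ‖T (Qtr ((j : ℕ)+1) (jle j) x)‖ := by
  rw [lyapV, qf, hT, real_inner_self_eq_norm_sq, Real.sqrt_sq (norm_nonneg _)]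

lemma abs_apply_le_norm_Qtr {N m : ℕ} (hm : m ≤ N) (x : EuclideanSpace ℝ (Fin N)) {i : Fin N}
    (hi : (i : ℕ) < m) : |x i| ≤ ‖Qtr m hm x‖ :=
  PiLp.norm_apply_le (Qtr m hm x) ⟨i, hi⟩

/-- Vector form of the first-order expansion of the first `j + 1` coordinates. -/
lemma exists_closedLoop_error (j : Fin (n+1)) (p : EuclideanSpace ℝ (Fin ((j : ℕ)+1)))
    {xa xb : EuclideanSpace ℝ (Fin (n+2))} {h w E : ℝ} (hE0 : 0 ≤ E)
    (hstep0 : xb 0 = xa 0 + h * (ip p (Qtr ((j : ℕ)+1) (jle j) xa) - w))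
    (hstep : ∀ i : Fin (n+2), (hi0 : (i : ℕ) ≠ 0) → (i : ℕ) ≤ (j : ℕ) + 1 →
      |xb i - xa i - h * xa ⟨(i : ℕ) - 1, by have := i.isLt; omega⟩| ≤ E) :
    ∃ e : EuclideanSpace ℝ (Fin ((j : ℕ)+1)), ‖e‖ ≤ (((j : ℕ) + 1 : ℕ) : ℝ) * E ∧
      Qtr ((j : ℕ)+1) (jle j) xb = Qtr ((j : ℕ)+1) (jle j) xa +
        h • mulVecL (matA ((j : ℕ)+1) + vecMulVec (vecbf ((j : ℕ)+1)) (ef p))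
          (Qtr ((j : ℕ)+1) (jle j) xa) - (h * w) • vecb ((j : ℕ)+1) + e := by
  refine ⟨Qtr ((j : ℕ)+1) (jle j) xb - (Qtr ((j : ℕ)+1) (jle j) xa +
        h • mulVecL (matA ((j : ℕ)+1) + vecMulVec (vecbf ((j : ℕ)+1)) (ef p))
          (Qtr ((j : ℕ)+1) (jle j) xa) - (h * w) • vecb ((j : ℕ)+1)),
    norm_le_of_abs_le hE0 fun i => ?_, by abel⟩
  rw [PiLp.sub_apply, PiLp.sub_apply, PiLp.add_apply, PiLp.smul_apply, PiLp.smul_apply,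
    mulVecL_apply, mulVecE_closedLoop_apply, smul_eq_mul, smul_eq_mul, Qtr_apply, Qtr_apply]
  have hb : vecb ((j : ℕ)+1) i = if (i : ℕ) = 0 then 1 else 0 := rfl
  rw [hb]
  by_cases hi : (i : ℕ) = 0
  · have hi' : Fin.castLE (jle j) i = 0 := Fin.ext hi
    rw [if_pos hi, if_pos hi, hi', hstep0]
    refine (le_of_eq ?_).trans hE0
    rw [abs_eq_zero]; ring
  · rw [if_neg hi, if_neg hi]
    have h2 := hstep (Fin.castLE (jle j) i) (by simpa using hi)
      (by have := i.isLt; simp only [Fin.val_castLE]; omega)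
    refine (le_of_eq ?_).trans h2
    congr 1
    rw [Qtr_apply]
    simp only [Fin.val_castLE, mul_zero, sub_zero, Fin.castLE_mk]
    ring

set_option maxHeartbeats 1000000 in
/-- The effect of one sampling interval on the Lyapunov function and on the saturated variable
of a mode, up to errors which are quadratic in the data or of second order in the step. -/
lemma mode_step {D : Set (EuclideanSpace ℝ (Fin l))}
    {g : Fin (n+2) → EuclideanSpace ℝ (Fin l) → EuclideanSpace ℝ (Fin (n+2)) → ℝ → ℝ}
    (hg : QuadraticGrowth D g) (j : Fin (n+1))
    {P : Matrix (Fin ((j : ℕ)+1)) (Fin ((j : ℕ)+1)) ℝ} (hP : P.PosDef)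
    {p c : EuclideanSpace ℝ (Fin ((j : ℕ)+1))}
    (hneg : (-(P * (matA ((j : ℕ)+1) + vecMulVec (vecbf ((j : ℕ)+1)) (ef p))
          + ((matA ((j : ℕ)+1))ᵀ + vecMulVec (ef p) (vecbf ((j : ℕ)+1))) * P)).PosDef)
    (hc : ef c = -((((matA ((j : ℕ)+1))ᵀ + vecMulVec (ef p) (vecbf ((j : ℕ)+1)))⁻¹).mulVec
          (Pi.single (Fin.last (j : ℕ)) 1))) :
    ip c (vecb ((j : ℕ)+1)) ≠ 0 ∧ ∃ μ ρ C : ℝ, 0 < μ ∧ 0 < ρ ∧ ρ ≤ 1 ∧ ρ * μ ≤ 1 ∧ 1 ≤ C ∧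
      ∀ (K : ℝ) (d : ℝ → EuclideanSpace ℝ (Fin l)) (x : ℝ → EuclideanSpace ℝ (Fin (n+2)))
        (v : ℝ → ℝ), 0 ≤ K → K ≤ 1 → (∀ t, d t ∈ D) → FFMeanValue g d x v →
      ∀ a b σ : ℝ, 0 ≤ a → a ≤ b → b ≤ a + ρ → |σ| ≤ 1 →
      (∀ s ∈ Ico a b, v s = ip p (Qtr ((j : ℕ)+1) (jle j) (x a))
        - K * ip c (vecb ((j : ℕ)+1)) * σ) → lyapV j P (x a) ≤ 1 →
      lyapV j P (x b) ≤ (1 - μ * (b - a)) * lyapV j P (x a) + (b - a) * (C * (K * |σ| +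
          (b - a) * (lyapV j P (x a) + K * |σ|) + (lyapV j P (x a) + K * |σ|) ^ 2)) ∧
      |outY j c (x b) - (outY j c (x a) - (b - a) * K * ip c (vecb ((j : ℕ)+1)) ^ 2 * σ)| ≤
        (b - a) * (C * ((b - a) * (lyapV j P (x a) + K * |σ|)
          + (lyapV j P (x a) + K * |σ|) ^ 2)) := by
  set F := matA ((j : ℕ)+1) + vecMulVec (vecbf ((j : ℕ)+1)) (ef p) with hF
  have hFt : (matA ((j : ℕ)+1))ᵀ + vecMulVec (ef p) (vecbf ((j : ℕ)+1)) = Fᵀ := by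
    rw [hF, transpose_add, transpose_vecMulVec]
  rw [hFt] at hneg hc
  have hcF := ip_c_closedLoop (isUnit_det_of_lyapunov hneg) hc
  refine ⟨ip_c_vecb_ne_zero hcF, ?_⟩
  obtain ⟨T, hT, κ, hκ0, hκ⟩ := exists_factor_of_posDef hP
  obtain ⟨μ, ρ, hμ, hρ, hρμ, hcontr⟩ := euler_step_contraction hneg hT hκ0 hκ
  set β := ip c (vecb ((j : ℕ)+1)) with hβ
  set C₁ := κ + ‖p‖ * κ + |β| with hC₁
  have hC₁0 : 0 ≤ C₁ := by positivity
  obtain ⟨C₂, hC₂1, hC₂⟩ := hg.step_expansion ((j : ℕ)+1) (B := C₁ * 2) (by positivity)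
  have hC₂0 : 0 ≤ C₂ := by linarith
  set C₃ := C₂ * (C₁ + C₁ ^ 2) with hC₃
  have hC₃0 : 0 ≤ C₃ := by positivity
  set m : ℝ := (((j : ℕ) + 1 : ℕ) : ℝ) with hm
  have hm0 : 0 ≤ m := by positivity
  set C := |β| * ‖T (vecb ((j : ℕ)+1))‖ + ‖T‖ * m * C₃ + (1 + ‖c‖ * m) * C₃ + 1 with hC
  have hCa : (1 + ‖c‖ * m) * C₃ ≤ C := by
    have : 0 ≤ |β| * ‖T (vecb ((j : ℕ)+1))‖ + ‖T‖ * m * C₃ := by positivity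
    linarith
  have hCb : |β| * ‖T (vecb ((j : ℕ)+1))‖ ≤ C := by
    have : 0 ≤ ‖T‖ * m * C₃ + (1 + ‖c‖ * m) * C₃ := by positivity
    linarith
  have hCd : ‖T‖ * m * C₃ ≤ C := by
    have : 0 ≤ |β| * ‖T (vecb ((j : ℕ)+1))‖ + (1 + ‖c‖ * m) * C₃ := by positivity
    linarith
  refine ⟨μ, min ρ 1, C, hμ, lt_min hρ one_pos, min_le_right _ _, ?_, ?_, ?_⟩
  · refine le_trans ?_ hρμ
    gcongr
    exact min_le_left _ _
  · have : 0 ≤ |β| * ‖T (vecb ((j : ℕ)+1))‖ + ‖T‖ * m * C₃ + (1 + ‖c‖ * m) * C₃ := by positivity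
    linarith
  intro K d x v hK0 hK1 hd hx a b σ ha hab hb hσ hv hV1
  set h := b - a with hh
  have hh0 : 0 ≤ h := by linarith
  have hhρ : h ≤ ρ := by linarith [min_le_left ρ 1]
  have hb1 : b ≤ a + 1 := by linarith [min_le_right ρ 1]
  set ξ := Qtr ((j : ℕ)+1) (jle j) (x a) with hξ
  set ξ' := Qtr ((j : ℕ)+1) (jle j) (x b) with hξ'
  have hVa : lyapV j P (x a) = ‖T ξ‖ := lyapV_eq_norm hT _
  have hVb : lyapV j P (x b) = ‖T ξ'‖ := lyapV_eq_norm hT _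
  rw [hVa] at hV1
  rw [hVa, hVb]
  set S := ‖T ξ‖ + K * |σ| with hS
  have hKσ0 : 0 ≤ K * |σ| := by positivity
  have hKσ1 : K * |σ| ≤ 1 := mul_le_one₀ hK1 (abs_nonneg _) hσ
  have hS0 : 0 ≤ S := by positivity
  have hS2 : S ≤ 2 := by linarith
  have hTS : ‖T ξ‖ ≤ S := by linarith
  have hξS : ‖ξ‖ ≤ κ * S := (hκ ξ).trans (by gcongr)
  have hu : |ip p ξ - K * β * σ| ≤ C₁ * S := by
    calc |ip p ξ - K * β * σ| ≤ |ip p ξ| + |K * β * σ| := abs_sub _ _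
      _ ≤ ‖p‖ * ‖ξ‖ + |β| * (K * |σ|) := by
        refine add_le_add (abs_ip_le _ _) (le_of_eq ?_)
        rw [abs_mul, abs_mul, abs_of_nonneg hK0]; ring
      _ ≤ ‖p‖ * (κ * S) + |β| * S := by gcongr; linarith [norm_nonneg (T ξ)]
      _ ≤ C₁ * S := by rw [hC₁]; nlinarith [mul_nonneg hκ0.le hS0]
  have hx0 : ∀ i : Fin (n+2), (i : ℕ) < (j : ℕ) + 1 → |x a i| ≤ C₁ * S := by
    intro i hi
    have h1 : |x a i| ≤ ‖ξ‖ := abs_apply_le_norm_Qtr (jle j) (x a) hi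
    refine h1.trans (hξS.trans ?_)
    gcongr
    rw [hC₁]
    have : 0 ≤ ‖p‖ * κ + |β| := by positivity
    linarith
  set E := h * (C₃ * (h * S + S ^ 2)) with hE
  have hE0 : 0 ≤ E := by positivity
  have hstep : ∀ i : Fin (n+2), (hi0 : (i : ℕ) ≠ 0) → (i : ℕ) ≤ (j : ℕ) + 1 →
        |x b i - x a i - h * x a ⟨(i : ℕ) - 1, by have := i.isLt; omega⟩| ≤ E := by
    intro i hi0 hij
    refine (hC₂ d x v hd hx a b (C₁ * S) ha hab hb1 (by positivity) (by gcongr)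
      (fun s hs => by rw [hv s hs]; exact hu) hx0 i hi0 hij).trans ?_
    rw [hE, hC₃]
    have : C₂ * (h * (C₁ * S) + (C₁ * S) ^ 2) ≤ C₂ * (C₁ + C₁ ^ 2) * (h * S + S ^ 2) := by
      have e1 : 0 ≤ C₂ * (C₁ * S ^ 2 + C₁ ^ 2 * (h * S)) := by positivity
      linarith
    gcongr
  have hstep0 : x b 0 = x a 0 + h * (ip p ξ - K * β * σ) := by
    have := hx 0 a b ha hab (ip p ξ - K * β * σ) 0 (by
      intro s hs
      simp [ffRhs, hv s hs])
    rw [zero_mul] at this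
    linarith [abs_nonpos_iff.1 this]
  obtain ⟨e, heE, hξ'e⟩ := exists_closedLoop_error j p hE0 hstep0 hstep
  rw [← hF, ← hξ, ← hξ'] at hξ'e
  rw [← hm] at heE
  constructor
  · rw [hξ'e, map_add, map_sub, map_smul]
    calc _ ≤ ‖T (ξ + h • mulVecL F ξ)‖ + ‖(h * (K * β * σ)) • T (vecb ((j : ℕ)+1))‖ + ‖T e‖ :=
          (norm_add_le _ _).trans (by gcongr; exact norm_sub_le _ _)
      _ ≤ (1 - μ * h) * ‖T ξ‖ + h * (K * |σ|) * (|β| * ‖T (vecb ((j : ℕ)+1))‖)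
            + ‖T‖ * (m * E) := by
        gcongr
        · exact hcontr h hh0 hhρ ξ
        · rw [norm_smul, Real.norm_eq_abs, abs_mul, abs_mul, abs_mul, abs_of_nonneg hh0,
            abs_of_nonneg hK0]
          exact le_of_eq (by ring)
        · exact (T.le_opNorm e).trans (by gcongr)
      _ = (1 - μ * h) * ‖T ξ‖ + h * ((|β| * ‖T (vecb ((j : ℕ)+1))‖) * (K * |σ|)
            + (‖T‖ * m * C₃) * (h * S + S ^ 2)) := by rw [hE]; ring
      _ ≤ (1 - μ * h) * ‖T ξ‖ + h * (C * (K * |σ|) + C * (h * S + S ^ 2)) := by gcongr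
      _ = _ := by ring
  · have hlast := hstep (nextIdx j) (by simp [nextIdx]) le_rfl
    have h1 : ip c ξ' = ip c ξ + h * ip c (mulVecE F ξ) - h * (K * β * σ) * β + ip c e := by
      rw [hξ'e]
      simp only [ip_eq_inner, inner_add_right, inner_sub_right, inner_smul_right, mulVecL_apply]
      rw [← ip_eq_inner _ (vecb _)]
    have h2 : outY j c (x b) - (outY j c (x a) - h * K * β ^ 2 * σ) =
        (x b (nextIdx j) - x a (nextIdx j) - h * ξ (Fin.last (j : ℕ))) + ip c e := by
      rw [outY, outY, ← hξ, ← hξ', h1, hcF]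
      ring
    rw [h2]
    calc _ ≤ E + ‖c‖ * (m * E) :=
          (abs_add_le _ _).trans (add_le_add hlast ((abs_ip_le c e).trans (by gcongr)))
      _ = h * (((1 + ‖c‖ * m) * C₃) * (h * S + S ^ 2)) := by rw [hE]; ring
      _ ≤ _ := by gcongr

end Mode

section Scalar

lemma eventually_pos_le {c : ℝ} (hc : 0 < c) :
    ∀ᶠ s in nhdsWithin (0 : ℝ) (Ioi 0), 0 < s ∧ s ≤ c := by
  filter_upwards [Ioc_mem_nhdsGT hc] with s hs using hs

lemma eventually_mul_le (A : ℝ) {c : ℝ} (hc : 0 < c) :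
    ∀ᶠ s in nhdsWithin (0 : ℝ) (Ioi 0), A * s ≤ c := by
  filter_upwards [eventually_pos_le (c := c / (|A| + 1)) (by positivity)] with s hs
  have h1 := (le_div_iff₀ (by positivity)).1 hs.2
  nlinarith [mul_le_mul_of_nonneg_right (le_abs_self A) hs.1.le]

lemma abs_sat (s : ℝ) : |sat s| = min 1 |s| := by
  rw [sat, abs_div, abs_of_pos (a := max 1 |s|) (by positivity)]
  rcases le_total |s| 1 with h | h
  · rw [max_eq_left h, min_eq_right h, div_one]
  · rw [max_eq_right h, min_eq_left h, div_self (by linarith)]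

lemma abs_sat_le_one (s : ℝ) : |sat s| ≤ 1 := by
  rw [abs_sat]; exact min_le_left _ _

lemma sub_mul_sat_abs {q ω y : ℝ} (hω : 0 < ω) (hqω : q * ω ≤ 1) :
    |y - q * sat (ω * y)| = |y| - q * min 1 (ω * |y|) := by
  have hm : 0 < max 1 |ω * y| := by positivity
  have h1 : y - q * sat (ω * y) = (1 - q * ω / max 1 |ω * y|) * y := by
    rw [sat]; field_simp
  have h2 : q * ω / max 1 |ω * y| ≤ 1 := by
    rw [div_le_one hm]; exact hqω.trans (le_max_left _ _)
  have h3 : min 1 (ω * |y|) = ω * |y| / max 1 |ω * y| := by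
    have := abs_sat (ω * y)
    rw [sat, abs_div, abs_of_pos hm, abs_mul, abs_of_pos hω] at this
    rw [← this, abs_mul, abs_of_pos hω]
  rw [h1, abs_mul, abs_of_nonneg (by linarith), h3]
  ring

lemma sub_mul_sat_abs_le {q ω y y₀ : ℝ} (hq : 0 ≤ q) (hω : 0 < ω) (hqω : q * ω ≤ 1) :
    |y - q * sat (ω * y)| ≤ max y₀ |y| - q * min 1 (ω * y₀) := by
  rw [sub_mul_sat_abs hω hqω]
  rcases le_total y₀ |y| with h | h
  · rw [max_eq_right h]
    gcongr
  · rw [max_eq_left h]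
    have h1 : min 1 (ω * y₀) ≤ min 1 (ω * |y|) + ω * (y₀ - |y|) := by
      rcases le_total 1 (ω * |y|) with h' | h'
      · rw [min_eq_left h']
        have := mul_nonneg hω.le (sub_nonneg.2 h)
        exact (min_le_left _ _).trans (by linarith)
      · rw [min_eq_right h']
        exact (min_le_right _ _).trans (by linarith)
    nlinarith [mul_le_mul_of_nonneg_left h1 hq,
      mul_le_mul_of_nonneg_right hqω (sub_nonneg.2 h)]

set_option maxHeartbeats 4000000 in
/-- Choice of the gain and of the sampling period for a single mode, in terms of the scalar
comparison inequalities satisfied over one sampling interval. -/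
lemma exists_mode_gains {μ ρ C γ ω : ℝ} (hμ : 0 < μ) (hρ : 0 < ρ) (hρμ : ρ * μ ≤ 1) (hC : 1 ≤ C)
    (hγ : 0 < γ) (hω : 0 < ω) :
    ∃ C₁ lam R : ℝ, 0 < C₁ ∧ 0 < lam ∧ 0 < R ∧ R ≤ 1 ∧ ∀ y₀ : ℝ, 0 < y₀ →
      ∀ᶠ K in nhdsWithin (0 : ℝ) (Ioi 0), ∃ κ : ℝ, 0 < κ ∧
      ∀ᶠ r in nhdsWithin (0 : ℝ) (Ioi 0), ∀ h V V' y y' : ℝ, 0 ≤ h → h ≤ r → 0 ≤ V → V < R →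
        V' ≤ (1 - μ * h) * V + h * (C * (K * |sat (ω * y)| + h * (V + K * |sat (ω * y)|)
          + (V + K * |sat (ω * y)|) ^ 2)) →
        |y' - (y - h * K * γ * sat (ω * y))| ≤ h * (C * (h * (V + K * |sat (ω * y)|)
          + (V + K * |sat (ω * y)|) ^ 2)) →
        V' < R ∧ V' ≤ max (C₁ * K) V - κ * h ∧
        (V ≤ C₁ * K → |y'| ≤ max y₀ |y| - κ * h) ∧
        (V ≤ C₁ * K → ω * |y| ≤ 1 → |y'| + lam * V' ≤ (1 - κ * h) * (|y| + lam * V)) := by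
  have hC0 : 0 < C := by linarith
  set ν := μ / 2 with hν
  have hν0 : 0 < ν := by positivity
  set C₁ := 8 * C / ν with hC₁
  have hC₁0 : 0 < C₁ := by positivity
  have hC₁ν : ν * C₁ = 8 * C := by rw [hC₁]; field_simp
  set C₄ := C * ω * (C₁ + 3) with hC₄
  have hC₄0 : 0 < C₄ := by positivity
  set lam := γ * ω / (4 * C₄) with hlam
  have hlam0 : 0 < lam := by positivity
  have hlamC : lam * C₄ = γ * ω / 4 := by rw [hlam]; field_simp
  set C₅ := C * (C₁ + 2) with hC₅
  have hC₅0 : 0 < C₅ := by positivity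
  set R := min 1 (μ / (6 * C)) with hR
  have hR0 : 0 < R := by positivity
  have hR1 : R ≤ 1 := min_le_left _ _
  have hRμ : 6 * C * R ≤ μ := by
    have : R ≤ μ / (6 * C) := min_le_right _ _
    rw [le_div_iff₀ (by positivity)] at this
    linarith
  refine ⟨C₁, lam, R, hC₁0, hlam0, hR0, hR1, fun y₀ hy₀ => ?_⟩
  set σ₀ := min 1 (ω * y₀) with hσ₀
  have hσ₀0 : 0 < σ₀ := by positivity
  filter_upwards [eventually_pos_le (lt_min one_pos hR0),
    eventually_mul_le (8 * C) (c := ν * R) (by positivity),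
    eventually_mul_le (2 * (C * ((C₁ + 1) + (C₁ + 1) ^ 2))) (c := γ * σ₀) (by positivity),
    eventually_mul_le C₅ hν0,
    eventually_mul_le (2 * (C₅ * ω)) (c := γ * ω) (by positivity),
    eventually_mul_le (2 * C₅) (c := ν * lam) (by positivity)]
    with K hK hK1 hK2 hK3 hK4 hK5
  have hK0 := hK.1
  have hKR : K ≤ R := hK.2.trans (min_le_right _ _)
  set κ := min (min (4 * C * K) (K * γ * σ₀ / 2)) (min (K * γ * ω / 4) (ν / 2)) with hκ
  have hκ1 : κ ≤ 4 * C * K := (min_le_left _ _).trans (min_le_left _ _)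
  have hκ2 : κ ≤ K * γ * σ₀ / 2 := (min_le_left _ _).trans (min_le_right _ _)
  have hκ3 : κ ≤ K * γ * ω / 4 := (min_le_right _ _).trans (min_le_left _ _)
  have hκ4 : κ ≤ ν / 2 := (min_le_right _ _).trans (min_le_right _ _)
  refine ⟨κ, by positivity, ?_⟩
  filter_upwards [eventually_pos_le (lt_min hρ (lt_min hR0 hK0)),
    eventually_mul_le (K * γ * ω) one_pos] with r hr hr1
  intro h V V' y y' hh0 hhr hV0 hVR hV' hy'
  have hhρ : h ≤ ρ := hhr.trans (hr.2.trans (min_le_left _ _))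
  have hhR : h ≤ R := hhr.trans (hr.2.trans ((min_le_right _ _).trans (min_le_left _ _)))
  have hhK : h ≤ K := hhr.trans (hr.2.trans ((min_le_right _ _).trans (min_le_right _ _)))
  have hνh : ν * h ≤ 1 := by
    have : h * μ ≤ ρ * μ := by gcongr
    rw [hν]; nlinarith
  set s := |sat (ω * y)| with hs
  have hs0 : 0 ≤ s := abs_nonneg _
  have hs1 : s ≤ 1 := abs_sat_le_one _
  have hKs0 : 0 ≤ K * s := by positivity
  have hKs : K * s ≤ K := mul_le_of_le_one_right hK0.le hs1
  have hS0 : 0 ≤ V + K * s := by positivity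
  have hqω : h * K * γ * ω ≤ 1 := by
    have : K * γ * ω * h ≤ K * γ * ω * r := by gcongr
    linarith
  have hq0 : 0 ≤ h * K * γ := by positivity
  -- contraction of the Lyapunov function up to the gain
  have hV1 : V' ≤ (1 - ν * h) * V + h * (4 * C * K) := by
    have e1 : h * (V + K * s) + (V + K * s) ^ 2 ≤ 3 * R * (V + K) := by
      calc h * (V + K * s) + (V + K * s) ^ 2 = (h + (V + K * s)) * (V + K * s) := by ring
        _ ≤ (R + (R + R)) * (V + K) := by gcongr; exact hKs.trans hKR
        _ = _ := by ring
    have e2 : C * (K * s + h * (V + K * s) + (V + K * s) ^ 2) ≤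
        C * (K + 3 * R * (V + K)) := by
      gcongr ?_ * ?_; linarith
    have e3 : C * (K + 3 * R * (V + K)) ≤ ν * V + 4 * C * K := by
      have a1 : 6 * C * R * V ≤ μ * V := by gcongr
      have a2 : 3 * C * K * R ≤ 3 * C * K * 1 := by gcongr
      rw [hν]; nlinarith
    have e4 := mul_le_mul_of_nonneg_left (e2.trans e3) hh0
    have : μ = 2 * ν := by rw [hν]; ring
    rw [this] at hV'
    linarith
  have hVsmall : ∀ {M : ℝ}, V ≤ M → C₁ * K ≤ M → V' ≤ M - h * (4 * C * K) := by
    intro M hVM hKM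
    have e1 : (1 - ν * h) * V ≤ (1 - ν * h) * M := by gcongr
    have e2 : h * (ν * (C₁ * K)) ≤ h * (ν * M) := by gcongr
    have e3 : h * (ν * (C₁ * K)) = h * (8 * C * K) := by rw [← mul_assoc ν, hC₁ν]
    linarith
  refine ⟨?_, ?_, ?_, ?_⟩
  · rcases hh0.eq_or_lt with h0 | h0
    · rw [← h0] at hV1; linarith
    · have e1 : C₁ * K ≤ R := by
        have : ν * (C₁ * K) ≤ ν * R := by rw [← mul_assoc, hC₁ν]; exact hK1
        exact le_of_mul_le_mul_left this hν0
      have e2 := hVsmall hVR.le e1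
      have : 0 < h * (4 * C * K) := by positivity
      linarith
  · have e1 := hVsmall (le_max_right (C₁ * K) V) (le_max_left _ _)
    have : κ * h ≤ 4 * C * K * h := by gcongr
    linarith
  · intro hVK
    have e1 : h * (V + K * s) + (V + K * s) ^ 2 ≤ ((C₁ + 1) + (C₁ + 1) ^ 2) * K ^ 2 := by
      calc h * (V + K * s) + (V + K * s) ^ 2 ≤ K * (C₁ * K + K) + (C₁ * K + K) ^ 2 := by gcongr
        _ = _ := by ring
    have e2 : C * (h * (V + K * s) + (V + K * s) ^ 2) ≤ K * γ * σ₀ / 2 := by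
      calc _ ≤ C * (((C₁ + 1) + (C₁ + 1) ^ 2) * K ^ 2) := by gcongr
        _ = (2 * (C * ((C₁ + 1) + (C₁ + 1) ^ 2)) * K) * K / 2 := by ring
        _ ≤ (γ * σ₀) * K / 2 := by gcongr
        _ = _ := by ring
    have e3 := mul_le_mul_of_nonneg_left e2 hh0
    have e4 := sub_mul_sat_abs_le (y := y) (y₀ := y₀) hq0 hω hqω
    have e5 := abs_sub_abs_le_abs_sub y' (y - h * K * γ * sat (ω * y))
    have : κ * h ≤ K * γ * σ₀ / 2 * h := by gcongr
    linarith
  · intro hVK hωy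
    have hsat : s = ω * |y| := by
      rw [hs, abs_sat, abs_mul, abs_of_pos hω, min_eq_right hωy]
    have hS : h + (V + K * s) ≤ (C₁ + 2) * K := by linarith
    have hb : C * (h * (V + K * s) + (V + K * s) ^ 2) ≤ C₅ * K * (V + K * s) := by
      calc _ = C * ((h + (V + K * s)) * (V + K * s)) := by ring
        _ ≤ C * (((C₁ + 2) * K) * (V + K * s)) := by gcongr
        _ = _ := by rw [hC₅]; ring
    have hV2 : V' ≤ (1 - ν * h) * V + h * (C₄ * K * |y|) := by
      have e1 : C * (K * s + h * (V + K * s) + (V + K * s) ^ 2) ≤ ν * V + C₄ * K * |y| := by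
        have a1 : C₅ * K * V ≤ ν * V := by gcongr
        have a2 : C₅ * K * (K * s) ≤ C₅ * 1 * (K * s) := by gcongr; exact hKR.trans hR1
        have a3 : C * (K * s) + C₅ * (K * s) = C₄ * K * |y| := by
          rw [hsat, hC₄, hC₅]; ring
        linarith
      have e4 := mul_le_mul_of_nonneg_left e1 hh0
      have : μ = 2 * ν := by rw [hν]; ring
      rw [this] at hV'
      linarith
    have hy2 : |y'| ≤ (1 - K * γ * ω / 2 * h) * |y| + h * (C₅ * K * V) := by
      have e1 : C₅ * K * (V + K * s) ≤ C₅ * K * V + K * γ * ω / 2 * |y| := by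
        have a1 : 2 * (C₅ * ω) * K * (K * |y|) ≤ γ * ω * (K * |y|) := by gcongr
        rw [hsat]; linarith
      have e2 := mul_le_mul_of_nonneg_left (hb.trans e1) hh0
      have e3 := sub_mul_sat_abs (y := y) hω hqω
      rw [min_eq_right hωy] at e3
      have e5 := abs_sub_abs_le_abs_sub y' (y - h * K * γ * sat (ω * y))
      linarith
    have f1 : lam * V' ≤ lam * ((1 - ν * h) * V + h * (C₄ * K * |y|)) := by gcongr
    have f2 : lam * (h * (C₄ * K * |y|)) = K * γ * ω / 4 * h * |y| := by
      calc _ = lam * C₄ * (h * K * |y|) := by ring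
        _ = _ := by rw [hlamC]; ring
    have f3 : h * (C₅ * K * V) ≤ ν / 2 * h * (lam * V) := by
      have : 2 * C₅ * K * (h * V) ≤ ν * lam * (h * V) := by gcongr
      linarith
    have f4 : κ * (h * |y|) ≤ K * γ * ω / 4 * (h * |y|) := by gcongr
    have f5 : κ * (h * (lam * V)) ≤ ν / 2 * (h * (lam * V)) := by gcongr
    linarith

/-- A sequence which decreases at a uniform rate as long as it exceeds a threshold. -/
lemma le_max_of_decay {τ a : ℕ → ℝ} {c κ : ℝ} (hκ : 0 ≤ κ) (hτ : Monotone τ) {i k : ℕ}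
    (hik : i ≤ k)
    (h : ∀ m, i ≤ m → m < k → a (m + 1) ≤ max c (a m) - κ * (τ (m + 1) - τ m)) :
    a k ≤ max c (a i - κ * (τ k - τ i)) := by
  induction k, hik using Nat.le_induction with
  | base => simp
  | succ k hik ih =>
    have h1 := h k hik (by omega)
    have h2 := ih fun m h1 h2 => h m h1 (by omega)
    have h3 : 0 ≤ κ * (τ (k + 1) - τ k) := mul_nonneg hκ (sub_nonneg.2 (hτ (by omega)))
    rcases le_max_iff.1 h2 with h4 | h4
    · rw [max_eq_left h4] at h1
      exact le_max_of_le_left (by linarith)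
    · rcases le_total c (a k) with h5 | h5
      · rw [max_eq_right h5] at h1
        exact le_max_of_le_right (by linarith)
      · rw [max_eq_left h5] at h1
        exact le_max_of_le_left (by linarith)

lemma le_exp_of_decay {τ a : ℕ → ℝ} {κ : ℝ} {i k : ℕ} (hik : i ≤ k)
    (ha : ∀ m, 0 ≤ a m)
    (h : ∀ m, i ≤ m → m < k → a (m + 1) ≤ (1 - κ * (τ (m + 1) - τ m)) * a m) :
    a k ≤ Real.exp (-(κ * (τ k - τ i))) * a i := by
  induction k, hik using Nat.le_induction with
  | base => simp
  | succ k hik ih =>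
    have h2 := ih fun m h1 h2 => h m h1 (by omega)
    calc a (k + 1) ≤ (1 - κ * (τ (k + 1) - τ k)) * a k := h k hik (by omega)
      _ ≤ Real.exp (-(κ * (τ (k + 1) - τ k))) * a k := by
        gcongr
        · exact ha k
        · linarith [Real.add_one_le_exp (-(κ * (τ (k + 1) - τ k)))]
      _ ≤ Real.exp (-(κ * (τ (k + 1) - τ k))) * (Real.exp (-(κ * (τ k - τ i))) * a i) := by
        gcongr
      _ = _ := by
        rw [← mul_assoc, ← Real.exp_add]
        congr 2
        ring

end Scalar

section Modes

variable {n : ℕ}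

/-- The Lyapunov function of a mode; mode `0` is the saturated feedback of the first state. -/
def modeV (P : (j : Fin (n+1)) → Matrix (Fin ((j : ℕ)+1)) (Fin ((j : ℕ)+1)) ℝ) (m : Fin (n+2))
    (x : EuclideanSpace ℝ (Fin (n+2))) : ℝ :=
  Fin.cases (motive := fun _ => ℝ) 0 (fun j => lyapV j (P j) x) m

/-- The saturated variable of a mode. -/
def modeY (c : (j : Fin (n+1)) → EuclideanSpace ℝ (Fin ((j : ℕ)+1))) (m : Fin (n+2))
    (x : EuclideanSpace ℝ (Fin (n+2))) : ℝ :=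
  Fin.cases (motive := fun _ => ℝ) (x 0) (fun j => outY j (c j) x) m

/-- The radius of the region in which a mode can be active. -/
def modeR (R : Fin (n+1) → ℝ) (m : Fin (n+2)) : ℝ :=
  Fin.cases (motive := fun _ => ℝ) 1 R m

@[simp] lemma modeV_zero (P : (j : Fin (n+1)) → Matrix (Fin ((j : ℕ)+1)) (Fin ((j : ℕ)+1)) ℝ)
    (x : EuclideanSpace ℝ (Fin (n+2))) : modeV P 0 x = 0 := rfl

@[simp] lemma modeV_succ (P : (j : Fin (n+1)) → Matrix (Fin ((j : ℕ)+1)) (Fin ((j : ℕ)+1)) ℝ)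
    (j : Fin (n+1)) (x : EuclideanSpace ℝ (Fin (n+2))) : modeV P j.succ x = lyapV j (P j) x := rfl

@[simp] lemma modeY_zero (c : (j : Fin (n+1)) → EuclideanSpace ℝ (Fin ((j : ℕ)+1)))
    (x : EuclideanSpace ℝ (Fin (n+2))) : modeY c 0 x = x 0 := rfl

@[simp] lemma modeY_succ (c : (j : Fin (n+1)) → EuclideanSpace ℝ (Fin ((j : ℕ)+1)))
    (j : Fin (n+1)) (x : EuclideanSpace ℝ (Fin (n+2))) : modeY c j.succ x = outY j (c j) x := rfl

@[simp] lemma modeR_zero (R : Fin (n+1) → ℝ) : modeR R 0 = 1 := rfl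

@[simp] lemma modeR_succ (R : Fin (n+1) → ℝ) (j : Fin (n+1)) : modeR R j.succ = R j := rfl

lemma modeV_nonneg (P : (j : Fin (n+1)) → Matrix (Fin ((j : ℕ)+1)) (Fin ((j : ℕ)+1)) ℝ)
    (m : Fin (n+2)) (x : EuclideanSpace ℝ (Fin (n+2))) : 0 ≤ modeV P m x := by
  cases m using Fin.cases with
  | zero => exact le_rfl
  | succ j => exact lyapV_nonneg j (P j) x

lemma modeR_le_one {R : Fin (n+1) → ℝ} (hR : ∀ j, R j ≤ 1) (m : Fin (n+2)) : modeR R m ≤ 1 := by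
  cases m using Fin.cases with
  | zero => exact le_rfl
  | succ j => exact hR j

/-- The mode active at a given state. -/
def modeIdx (P : (j : Fin (n+1)) → Matrix (Fin ((j : ℕ)+1)) (Fin ((j : ℕ)+1)) ℝ)
    (R : Fin (n+1) → ℝ) (x : EuclideanSpace ℝ (Fin (n+2))) : Fin (n+2) :=
  (Finset.univ.filter fun m => modeV P m x < modeR R m).max' ⟨0, by simp⟩

variable {P : (j : Fin (n+1)) → Matrix (Fin ((j : ℕ)+1)) (Fin ((j : ℕ)+1)) ℝ}
  {R : Fin (n+1) → ℝ} {x : EuclideanSpace ℝ (Fin (n+2))}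

lemma modeV_modeIdx_lt (P : (j : Fin (n+1)) → Matrix (Fin ((j : ℕ)+1)) (Fin ((j : ℕ)+1)) ℝ)
    (R : Fin (n+1) → ℝ) (x : EuclideanSpace ℝ (Fin (n+2))) :
    modeV P (modeIdx P R x) x < modeR R (modeIdx P R x) := by
  have := Finset.max'_mem (Finset.univ.filter fun m => modeV P m x < modeR R m) ⟨0, by simp⟩
  exact (Finset.mem_filter.1 this).2

lemma le_modeIdx {m : Fin (n+2)} (h : modeV P m x < modeR R m) : m ≤ modeIdx P R x :=
  Finset.le_max' _ _ (by simpa using h)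

lemma qf_lt_sq_iff {j : Fin (n+1)} (hR : 0 < R j) :
    qf (P j) (Qtr ((j : ℕ)+1) (jle j) x) < (R j) ^ 2 ↔ modeV P j.succ x < modeR R j.succ := by
  rw [modeV_succ, modeR_succ, lyapV, Real.sqrt_lt' hR]

lemma kfb_of_modeIdx_eq_zero {K0 : ℝ} {ω : Fin (n+2) → ℝ}
    {p c : (j : Fin (n+1)) → EuclideanSpace ℝ (Fin ((j : ℕ)+1))} {K : Fin (n+1) → ℝ}
    (hR : ∀ j, 0 < R j) (h : modeIdx P R x = 0) :
    kfb n K0 ω P p c K R x = -K0 * sat (ω 0 * x 0) := by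
  rw [kfb, dif_neg]
  rintro ⟨j, hj⟩
  have h1 := le_modeIdx ((qf_lt_sq_iff (hR j)).1 (by simpa using hj))
  rw [h] at h1
  exact absurd h1 (by simp)

lemma kfb_of_modeIdx_eq_succ {K0 : ℝ} {ω : Fin (n+2) → ℝ}
    {p c : (j : Fin (n+1)) → EuclideanSpace ℝ (Fin ((j : ℕ)+1))} {K : Fin (n+1) → ℝ}
    (hR : ∀ j, 0 < R j) {j : Fin (n+1)} (h : modeIdx P R x = j.succ) :
    kfb n K0 ω P p c K R x = ip (p j) (Qtr ((j : ℕ)+1) (jle j) x)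
      - K j * ip (c j) (vecb ((j : ℕ)+1)) * sat (ω j.succ * outY j (c j) x) := by
  classical
  have hj : qf (P j) (Qtr ((j : ℕ)+1) (jle j) x) < (R j) ^ 2 := by
    rw [qf_lt_sq_iff (hR j), ← h]; exact modeV_modeIdx_lt P R x
  have hne : (Finset.univ.filter fun i : Fin (n+1) =>
      qf (P i) (Qtr ((i : ℕ)+1) (jle i) x) < (R i) ^ 2).Nonempty := ⟨j, by simpa using hj⟩
  have hmax : (Finset.univ.filter fun i : Fin (n+1) =>
      qf (P i) (Qtr ((i : ℕ)+1) (jle i) x) < (R i) ^ 2).max' hne = j := by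
    refine le_antisymm (Finset.max'_le _ _ _ fun i hi => ?_)
      (Finset.le_max' _ _ (by simpa using hj))
    have h1 := le_modeIdx ((qf_lt_sq_iff (hR i)).1 (by simpa using hi))
    rw [h] at h1
    exact Fin.succ_le_succ_iff.1 h1
  have key : kfb n K0 ω P p c K R x = (fun i : Fin (n+1) => ip (p i) (Qtr ((i : ℕ)+1) (jle i) x)
      - K i * ip (c i) (vecb ((i : ℕ)+1)) * sat (ω i.succ * outY i (c i) x))
      ((Finset.univ.filter fun i : Fin (n+1) =>
        qf (P i) (Qtr ((i : ℕ)+1) (jle i) x) < (R i) ^ 2).max' hne) := by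
    rw [kfb, dif_pos (by convert hne)]
    simp only [outY, nextIdx]
    congr!
  rw [key, hmax]

end Modes

section Comparison

variable {n : ℕ} {P : (j : Fin (n+1)) → Matrix (Fin ((j : ℕ)+1)) (Fin ((j : ℕ)+1)) ℝ}

/-- The coordinates up to the index of a mode are controlled by the data of the mode. -/
lemma exists_abs_apply_le (hP : ∀ j, (P j).PosDef)
    (c : (j : Fin (n+1)) → EuclideanSpace ℝ (Fin ((j : ℕ)+1))) :
    ∃ C : ℝ, 1 ≤ C ∧ ∀ (m : Fin (n+2)) (x : EuclideanSpace ℝ (Fin (n+2))),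
      (∀ i, i < m → |x i| ≤ C * modeV P m x) ∧ |x m| ≤ C * (modeV P m x + |modeY c m x|) := by
  have hj : ∀ j : Fin (n+1), ∃ κ > 0, ∀ x, ‖Qtr ((j : ℕ)+1) (jle j) x‖ ≤ κ * lyapV j (P j) x := by
    intro j
    obtain ⟨T, hT, κ, hκ0, hκ⟩ := exists_factor_of_posDef (hP j)
    exact ⟨κ, hκ0, fun x => by rw [lyapV_eq_norm hT]; exact hκ _⟩
  choose κ hκ0 hκ using hj
  have hsum : ∀ j, κ j * (1 + ‖c j‖) ≤ ∑ j, κ j * (1 + ‖c j‖) := fun j =>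
    Finset.single_le_sum (f := fun j => κ j * (1 + ‖c j‖))
      (fun j _ => mul_nonneg (hκ0 j).le (by positivity)) (Finset.mem_univ j)
  have hsum0 : 0 ≤ ∑ j, κ j * (1 + ‖c j‖) :=
    Finset.sum_nonneg fun j _ => mul_nonneg (hκ0 j).le (by positivity)
  refine ⟨1 + ∑ j, κ j * (1 + ‖c j‖), by linarith, fun m x => ?_⟩
  cases m using Fin.cases with
  | zero =>
    refine ⟨fun i hi => absurd hi (by simp), ?_⟩
    simp only [modeV_zero, modeY_zero, zero_add]
    nlinarith [abs_nonneg (x 0)]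
  | succ j =>
    have hV := lyapV_nonneg j (P j) x
    have h1 : κ j * (1 + ‖c j‖) * lyapV j (P j) x ≤
        (∑ j, κ j * (1 + ‖c j‖)) * lyapV j (P j) x := by gcongr; exact hsum j
    have h2 : 0 ≤ κ j * ‖c j‖ * lyapV j (P j) x :=
      mul_nonneg (mul_nonneg (hκ0 j).le (norm_nonneg _)) hV
    have h3 : 0 ≤ κ j * lyapV j (P j) x := mul_nonneg (hκ0 j).le hV
    refine ⟨fun i hi => ?_, ?_⟩
    · have h4 := (abs_apply_le_norm_Qtr (jle j) x (Fin.lt_def.1 hi)).trans (hκ j x)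
      rw [modeV_succ]
      linarith
    · have h4 := abs_ip_le (c j) (Qtr ((j : ℕ)+1) (jle j) x)
      have h5 : ‖c j‖ * ‖Qtr ((j : ℕ)+1) (jle j) x‖ ≤ ‖c j‖ * (κ j * lyapV j (P j) x) := by
        gcongr; exact hκ j x
      have h6 : x j.succ = outY j (c j) x - ip (c j) (Qtr ((j : ℕ)+1) (jle j) x) := by
        rw [outY]; simp only [nextIdx]; exact (add_sub_cancel_right _ _).symm
      have h7 := abs_sub (outY j (c j) x) (ip (c j) (Qtr ((j : ℕ)+1) (jle j) x))
      rw [modeV_succ, modeY_succ, h6]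
      have h8 := mul_nonneg hsum0 (abs_nonneg (outY j (c j) x))
      linarith

/-- The data of a mode are controlled by the coordinates up to the index of the mode. -/
lemma exists_modeV_le (hP : ∀ j, (P j).PosDef)
    (c : (j : Fin (n+1)) → EuclideanSpace ℝ (Fin ((j : ℕ)+1))) :
    ∃ C : ℝ, 1 ≤ C ∧ ∀ (m : Fin (n+2)) (x : EuclideanSpace ℝ (Fin (n+2))) (S : ℝ), 0 ≤ S →
      (∀ i, i < m → |x i| ≤ S) → modeV P m x ≤ C * S ∧ (|x m| ≤ S → |modeY c m x| ≤ C * S) := by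
  have hj : ∀ j : Fin (n+1), ∃ κ, 0 ≤ κ ∧
      ∀ x, lyapV j (P j) x ≤ κ * ‖Qtr ((j : ℕ)+1) (jle j) x‖ := by
    intro j
    obtain ⟨T, hT, -, -, -⟩ := exists_factor_of_posDef (hP j)
    exact ⟨‖T‖, norm_nonneg _, fun x => by rw [lyapV_eq_norm hT]; exact T.le_opNorm _⟩
  choose κ hκ0 hκ using hj
  have hterm : ∀ j, 0 ≤ (κ j + ‖c j‖) * (((j : ℕ) + 1 : ℕ) : ℝ) := fun j =>
    mul_nonneg (add_nonneg (hκ0 j) (norm_nonneg _)) (Nat.cast_nonneg _)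
  have hsum : ∀ j, (κ j + ‖c j‖) * (((j : ℕ) + 1 : ℕ) : ℝ) ≤
      ∑ j : Fin (n+1), (κ j + ‖c j‖) * (((j : ℕ) + 1 : ℕ) : ℝ) := fun j =>
    Finset.single_le_sum (f := fun j : Fin (n+1) => (κ j + ‖c j‖) * (((j : ℕ) + 1 : ℕ) : ℝ))
      (fun j _ => hterm j) (Finset.mem_univ j)
  have hsum0 : 0 ≤ ∑ j : Fin (n+1), (κ j + ‖c j‖) * (((j : ℕ) + 1 : ℕ) : ℝ) :=
    Finset.sum_nonneg fun j _ => hterm j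
  refine ⟨1 + ∑ j : Fin (n+1), (κ j + ‖c j‖) * (((j : ℕ) + 1 : ℕ) : ℝ), by linarith,
    fun m x S hS h => ?_⟩
  cases m using Fin.cases with
  | zero =>
    rw [modeV_zero, modeY_zero]
    have := mul_nonneg hsum0 hS
    exact ⟨by linarith, fun h => by linarith⟩
  | succ j =>
    have h1 : ‖Qtr ((j : ℕ)+1) (jle j) x‖ ≤ (((j : ℕ) + 1 : ℕ) : ℝ) * S :=
      norm_le_of_abs_le hS fun i => h _ (Fin.lt_def.2 i.isLt)
    have h2 : (κ j + ‖c j‖) * (((j : ℕ) + 1 : ℕ) : ℝ) * S ≤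
        (∑ j : Fin (n+1), (κ j + ‖c j‖) * (((j : ℕ) + 1 : ℕ) : ℝ)) * S := by
      gcongr; exact hsum j
    have h3 : κ j * ‖Qtr ((j : ℕ)+1) (jle j) x‖ ≤ κ j * ((((j : ℕ) + 1 : ℕ) : ℝ) * S) := by
      have := hκ0 j
      gcongr
    have h4 : ‖c j‖ * ‖Qtr ((j : ℕ)+1) (jle j) x‖ ≤ ‖c j‖ * ((((j : ℕ) + 1 : ℕ) : ℝ) * S) := by
      gcongr
    have h5 : 0 ≤ κ j * ((((j : ℕ) + 1 : ℕ) : ℝ) * S) :=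
      mul_nonneg (hκ0 j) (mul_nonneg (Nat.cast_nonneg _) hS)
    have h6 : 0 ≤ ‖c j‖ * ((((j : ℕ) + 1 : ℕ) : ℝ) * S) :=
      mul_nonneg (norm_nonneg _) (mul_nonneg (Nat.cast_nonneg _) hS)
    refine ⟨?_, fun hx => ?_⟩
    · rw [modeV_succ]
      linarith [hκ j x]
    · have h7 := abs_ip_le (c j) (Qtr ((j : ℕ)+1) (jle j) x)
      have h8 := abs_add_le (x j.succ) (ip (c j) (Qtr ((j : ℕ)+1) (jle j) x))
      have h9 : modeY c j.succ x = x j.succ + ip (c j) (Qtr ((j : ℕ)+1) (jle j) x) := rfl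
      rw [h9]
      linarith

/-- The feedback law is dominated by the data of the active mode. -/
lemma exists_abs_kfb_le (hP : ∀ j, (P j).PosDef) {K0 : ℝ} {ω : Fin (n+2) → ℝ}
    {p c : (j : Fin (n+1)) → EuclideanSpace ℝ (Fin ((j : ℕ)+1))} {K R : Fin (n+1) → ℝ}
    (hR : ∀ j, 0 < R j) :
    ∃ C : ℝ, 1 ≤ C ∧ ∀ x : EuclideanSpace ℝ (Fin (n+2)), |kfb n K0 ω P p c K R x| ≤
      C * (modeV P (modeIdx P R x) x + min 1 |modeY c (modeIdx P R x) x|) := by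
  have hj : ∀ j : Fin (n+1), ∃ κ > 0, ∀ x, ‖Qtr ((j : ℕ)+1) (jle j) x‖ ≤ κ * lyapV j (P j) x := by
    intro j
    obtain ⟨T, hT, κ, hκ0, hκ⟩ := exists_factor_of_posDef (hP j)
    exact ⟨κ, hκ0, fun x => by rw [lyapV_eq_norm hT]; exact hκ _⟩
  choose κ hκ0 hκ using hj
  have hsat : ∀ (m : Fin (n+2)) (y : ℝ), |sat (ω m * y)| ≤ (1 + |ω m|) * min 1 |y| := by
    intro m y
    rw [abs_sat, abs_mul]
    have h0 := abs_nonneg (ω m)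
    rcases le_total 1 |y| with h | h
    · rw [min_eq_left h]; exact (min_le_left _ _).trans (by linarith)
    · rw [min_eq_right h]; exact (min_le_right _ _).trans (by nlinarith [abs_nonneg y])
  set a : Fin (n+1) → ℝ := fun j => ‖p j‖ * κ j +
    |K j * ip (c j) (vecb ((j : ℕ)+1))| * (1 + |ω j.succ|) with ha
  have ha0 : ∀ j, 0 ≤ a j := fun j => by have := hκ0 j; positivity
  have hsum : ∀ j, a j ≤ ∑ j, a j := fun j =>
    Finset.single_le_sum (fun j _ => ha0 j) (Finset.mem_univ j)
  have hsum0 : 0 ≤ ∑ j, a j := Finset.sum_nonneg fun j _ => ha0 j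
  refine ⟨1 + |K0| * (1 + |ω 0|) + ∑ j, a j, ?_, fun x => ?_⟩
  · have : 0 ≤ |K0| * (1 + |ω 0|) := by positivity
    linarith
  generalize hm : modeIdx P R x = m
  cases m using Fin.cases with
  | zero =>
    rw [kfb_of_modeIdx_eq_zero hR hm, modeV_zero, modeY_zero, zero_add, abs_mul, abs_neg]
    have h1 : |K0| * |sat (ω 0 * x 0)| ≤ |K0| * ((1 + |ω 0|) * min 1 |x 0|) := by
      gcongr; exact hsat 0 _
    have h2 : 0 ≤ min 1 |x 0| := by positivity
    nlinarith
  | succ j =>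
    rw [kfb_of_modeIdx_eq_succ hR hm, modeV_succ, modeY_succ]
    have hV := lyapV_nonneg j (P j) x
    have hY : 0 ≤ min 1 |outY j (c j) x| := by positivity
    set Y := min 1 |outY j (c j) x|
    set V := lyapV j (P j) x
    have h1 := (abs_ip_le (p j) (Qtr ((j : ℕ)+1) (jle j) x)).trans
      (mul_le_mul_of_nonneg_left (hκ j x) (norm_nonneg _))
    have h2 : |K j * ip (c j) (vecb ((j : ℕ)+1)) * sat (ω j.succ * outY j (c j) x)| ≤
        |K j * ip (c j) (vecb ((j : ℕ)+1))| * ((1 + |ω j.succ|) * Y) := by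
      rw [abs_mul]; gcongr; exact hsat _ _
    have h3 := abs_sub (ip (p j) (Qtr ((j : ℕ)+1) (jle j) x))
      (K j * ip (c j) (vecb ((j : ℕ)+1)) * sat (ω j.succ * outY j (c j) x))
    have h4 : ‖p j‖ * κ j ≤ a j := le_add_of_nonneg_right (by positivity)
    have h5 : |K j * ip (c j) (vecb ((j : ℕ)+1))| * (1 + |ω j.succ|) ≤ a j :=
      le_add_of_nonneg_left (mul_nonneg (norm_nonneg _) (hκ0 j).le)
    have h6 : 0 ≤ |K0| * (1 + |ω 0|) := by positivity
    have h7 : a j ≤ 1 + |K0| * (1 + |ω 0|) + ∑ j, a j := by linarith [hsum j]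
    calc _ ≤ ‖p j‖ * κ j * V + |K j * ip (c j) (vecb ((j : ℕ)+1))| * (1 + |ω j.succ|) * Y := by
          linarith
      _ ≤ (1 + |K0| * (1 + |ω 0|) + ∑ j, a j) * V + (1 + |K0| * (1 + |ω 0|) + ∑ j, a j) * Y := by
          gcongr
          · exact h4.trans h7
          · exact h5.trans h7
      _ = _ := by ring

end Comparison

section Gains

variable {n l : ℕ}

/-- The decrease over one sampling interval of length `h` of the data of the mode `m`: the
Lyapunov function first decreases below `θ m`, and then the saturated variable decreases below
`y₀ m`. -/
def ModeDecay (P : (j : Fin (n+1)) → Matrix (Fin ((j : ℕ)+1)) (Fin ((j : ℕ)+1)) ℝ)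
    (c : (j : Fin (n+1)) → EuclideanSpace ℝ (Fin ((j : ℕ)+1))) (R : Fin (n+1) → ℝ)
    (θ κ y₀ : Fin (n+2) → ℝ) (m : Fin (n+2)) (h : ℝ) (xa xb : EuclideanSpace ℝ (Fin (n+2))) :
    Prop :=
  modeV P m xb < modeR R m ∧ modeV P m xb ≤ max (θ m) (modeV P m xa) - κ m * h ∧
    (modeV P m xa ≤ θ m → |modeY c m xb| ≤ max (y₀ m) |modeY c m xa| - κ m * h)

/-- The weighted data of the last mode. -/
def lastW (P : (j : Fin (n+1)) → Matrix (Fin ((j : ℕ)+1)) (Fin ((j : ℕ)+1)) ℝ)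
    (c : (j : Fin (n+1)) → EuclideanSpace ℝ (Fin ((j : ℕ)+1))) (lam : ℝ)
    (x : EuclideanSpace ℝ (Fin (n+2))) : ℝ :=
  |modeY c (Fin.last (n+1)) x| + lam * modeV P (Fin.last (n+1)) x

/-- The state is in the region where the last mode is active and unsaturated. -/
def AtLast (P : (j : Fin (n+1)) → Matrix (Fin ((j : ℕ)+1)) (Fin ((j : ℕ)+1)) ℝ)
    (c : (j : Fin (n+1)) → EuclideanSpace ℝ (Fin ((j : ℕ)+1))) (R : Fin (n+1) → ℝ)
    (θ y₀ : Fin (n+2) → ℝ) (x : EuclideanSpace ℝ (Fin (n+2))) : Prop :=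
  modeIdx P R x = Fin.last (n+1) ∧ modeV P (Fin.last (n+1)) x ≤ θ (Fin.last (n+1)) ∧
    |modeY c (Fin.last (n+1)) x| ≤ y₀ (Fin.last (n+1))

/-- The decrease over one sampling interval of length `h`: that of the active mode, and a
proportional decrease once the last mode is unsaturated. -/
def LoopDecay (P : (j : Fin (n+1)) → Matrix (Fin ((j : ℕ)+1)) (Fin ((j : ℕ)+1)) ℝ)
    (c : (j : Fin (n+1)) → EuclideanSpace ℝ (Fin ((j : ℕ)+1))) (R : Fin (n+1) → ℝ)
    (θ κ y₀ : Fin (n+2) → ℝ) (lam h : ℝ) (xa xb : EuclideanSpace ℝ (Fin (n+2))) : Prop :=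
  ModeDecay P c R θ κ y₀ (modeIdx P R xa) h xa xb ∧
    (AtLast P c R θ y₀ xa →
      lastW P c lam xb ≤ (1 - κ (Fin.last (n+1)) * h) * lastW P c lam xa)

lemma exists_modeV_succ_le {P : (j : Fin (n+1)) → Matrix (Fin ((j : ℕ)+1)) (Fin ((j : ℕ)+1)) ℝ}
    (hP : ∀ j, (P j).PosDef) (c : (j : Fin (n+1)) → EuclideanSpace ℝ (Fin ((j : ℕ)+1))) :
    ∃ C : ℝ, 0 < C ∧ ∀ (j : Fin (n+1)) (x : EuclideanSpace ℝ (Fin (n+2))),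
      modeV P j.succ x ≤ C * (modeV P j.castSucc x + |modeY c j.castSucc x|) := by
  obtain ⟨C, hC, hcoord⟩ := exists_abs_apply_le hP c
  obtain ⟨C', hC', hV⟩ := exists_modeV_le hP c
  have hC0 : 0 ≤ C := by linarith
  refine ⟨C' * C, by positivity, fun j x => ?_⟩
  have hV0 := modeV_nonneg P j.castSucc x
  rw [mul_assoc]
  refine (hV j.succ x _ (by positivity) fun i hi => ?_).1
  rcases (Fin.le_castSucc_iff.2 hi).lt_or_eq with h | h
  · refine ((hcoord j.castSucc x).1 i h).trans ?_
    gcongr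
    linarith [abs_nonneg (modeY c j.castSucc x)]
  · rw [h]; exact (hcoord j.castSucc x).2

/-- The gains, the radii and the sampling period can be chosen such that every mode decreases
and hands over to the next one. -/
lemma exists_gains {D : Set (EuclideanSpace ℝ (Fin l))}
    {g : Fin (n+2) → EuclideanSpace ℝ (Fin l) → EuclideanSpace ℝ (Fin (n+2)) → ℝ → ℝ}
    (hg : QuadraticGrowth D g) {K0 : ℝ} (hK0 : 0 < K0) {ω : Fin (n+2) → ℝ} (hω : ∀ i, 0 < ω i)
    {P : (j : Fin (n+1)) → Matrix (Fin ((j : ℕ)+1)) (Fin ((j : ℕ)+1)) ℝ}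
    (hP : ∀ j, (P j).PosDef)
    {p c : (j : Fin (n+1)) → EuclideanSpace ℝ (Fin ((j : ℕ)+1))}
    (hneg : ∀ j : Fin (n+1),
      (-(P j * (matA ((j : ℕ)+1) + vecMulVec (vecbf ((j : ℕ)+1)) (ef (p j)))
          + ((matA ((j : ℕ)+1))ᵀ + vecMulVec (ef (p j)) (vecbf ((j : ℕ)+1))) * P j)).PosDef)
    (hc : ∀ j : Fin (n+1), ef (c j) =
      -((((matA ((j : ℕ)+1))ᵀ + vecMulVec (ef (p j)) (vecbf ((j : ℕ)+1)))⁻¹).mulVec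
          (Pi.single (Fin.last (j : ℕ)) 1))) :
    ∃ r : ℝ, 0 < r ∧ ∃ K R : Fin (n+1) → ℝ, (∀ j, 0 < K j) ∧ (∀ j, 0 < R j) ∧
      (∀ j, R j ≤ 1) ∧ ∃ (θ κ y₀ : Fin (n+2) → ℝ) (lam : ℝ),
      (∀ m, 0 < θ m) ∧ (∀ m, 0 < κ m) ∧ (∀ m, 0 < y₀ m) ∧ 0 < lam ∧
      (∀ (j : Fin (n+1)) (x : EuclideanSpace ℝ (Fin (n+2))), modeV P j.castSucc x ≤ θ j.castSucc →
        |modeY c j.castSucc x| ≤ y₀ j.castSucc → modeV P j.succ x < modeR R j.succ) ∧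
      ∀ (d : ℝ → EuclideanSpace ℝ (Fin l)) (x : ℝ → EuclideanSpace ℝ (Fin (n+2))) (v : ℝ → ℝ),
        (∀ t, d t ∈ D) → FFMeanValue g d x v → ∀ a b : ℝ, 0 ≤ a → a ≤ b → b ≤ a + r →
        (∀ s ∈ Ico a b, v s = kfb n K0 ω P p c K R (x a)) →
        LoopDecay P c R θ κ y₀ lam (b - a) (x a) (x b) := by
  obtain ⟨C₅, hC₅, hnext⟩ := exists_modeV_succ_le hP c
  choose hβ μ ρ C hμ hρ hρ1 hρμ hC hstep using fun j => mode_step hg j (hP j) (hneg j) (hc j)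
  have hγ : ∀ j, 0 < ip (c j) (vecb ((j : ℕ)+1)) ^ 2 := fun j => by have := hβ j; positivity
  choose C₁ lam R hC₁ hlam hR hR1 hgain using fun j =>
    exists_mode_gains (hμ j) (hρ j) (hρμ j) (hC j) (hγ j) (hω (Fin.succ j))
  set y₀ : Fin (n+2) → ℝ := Fin.lastCases (motive := fun _ => ℝ) (1 / ω (Fin.last (n+1)))
    (fun j => R j / (4 * C₅)) with hy₀
  have hy₀l : y₀ (Fin.last (n+1)) = 1 / ω (Fin.last (n+1)) := Fin.lastCases_last ..
  have hy₀c : ∀ j : Fin (n+1), y₀ j.castSucc = R j / (4 * C₅) := fun j => Fin.lastCases_castSucc ..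
  have hy₀0 : ∀ m, 0 < y₀ m := by
    intro m
    cases m using Fin.lastCases with
    | last => rw [hy₀l]; have := hω (Fin.last (n+1)); positivity
    | cast j => rw [hy₀c]; have := hR j; positivity
  have hKex : ∀ j, ∃ K : ℝ, (0 < K ∧ K ≤ 1) ∧ (∀ i, C₅ * C₁ j * K ≤ R i / 4) ∧ _ := fun j =>
    ((eventually_pos_le one_pos).and ((Filter.eventually_all.2 fun i =>
      eventually_mul_le (C₅ * C₁ j) (by have := hR i; positivity)).and
        (hgain j (y₀ j.succ) (hy₀0 _)))).exists
  choose K hK hKR κ hκ hr using hKex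
  obtain ⟨r, hr0, hrρ, hrω, hrgain⟩ := ((eventually_pos_le one_pos).and
    ((Filter.eventually_all.2 fun j => eventually_pos_le (hρ j)).and
      ((eventually_mul_le (K0 * ω 0) one_pos).and (Filter.eventually_all.2 hr)))).exists
  set κ₀ := min 1 (K0 * min 1 (ω 0 * y₀ 0)) with hκ₀
  have hκ₀0 : 0 < κ₀ := by have := hω 0; have := hy₀0 0; positivity
  refine ⟨r, hr0.1, K, R, fun j => (hK j).1, hR, hR1,
    Fin.cases (motive := fun _ => ℝ) 1 (fun j => C₁ j * K j),
    Fin.cases (motive := fun _ => ℝ) κ₀ κ, y₀, lam (Fin.last n), fun m => ?_, fun m => ?_, hy₀0,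
    hlam _, fun j x hθ hy => ?_, fun d x v hd hx a b ha hab hbr hv => ?_⟩
  · cases m using Fin.cases with
    | zero => exact one_pos
    | succ j => exact mul_pos (hC₁ j) (hK j).1
  · cases m using Fin.cases with
    | zero => exact hκ₀0
    | succ j => exact hκ j
  · have h1 : C₅ * modeV P j.castSucc x ≤ R j / 4 := by
      generalize hm : j.castSucc = m at hθ
      cases m using Fin.cases with
      | zero => rw [modeV_zero, mul_zero]; have := hR j; positivity
      | succ i =>
        have : C₅ * modeV P i.succ x ≤ C₅ * (C₁ i * K i) := mul_le_mul_of_nonneg_left hθ hC₅.le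
        linarith [hKR i j]
    have h2 : C₅ * |modeY c j.castSucc x| ≤ C₅ * (R j / (4 * C₅)) := by
      rw [← hy₀c]; gcongr
    have h3 : C₅ * (R j / (4 * C₅)) = R j / 4 := by field_simp
    rw [modeR_succ]
    linarith [hnext j x, hR j]
  · have hh0 : 0 ≤ b - a := by linarith
    have hhr : b - a ≤ r := by linarith
    have hmode : ∀ j : Fin (n+1), modeIdx P R (x a) = j.succ → _ := fun j hj => by
      have hVR : lyapV j (P j) (x a) < R j := by
        have := modeV_modeIdx_lt P R (x a)
        rwa [hj] at this
      obtain ⟨e1, e2⟩ := hstep j (K j) d x v (hK j).1.le (hK j).2 hd hx a b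
        (sat (ω j.succ * outY j (c j) (x a))) ha hab (by linarith [(hrρ j).2]) (abs_sat_le_one _)
        (fun s hs => by rw [hv s hs, kfb_of_modeIdx_eq_succ hR hj]) (hVR.le.trans (hR1 j))
      exact hrgain j (b - a) _ _ _ _ hh0 hhr (lyapV_nonneg j (P j) (x a)) hVR e1 e2
    refine ⟨?_, fun ⟨hlast, hθ, hy⟩ => ?_⟩
    · generalize hm : modeIdx P R (x a) = m
      cases m using Fin.cases with
      | zero =>
        have hx0 := hx 0 a b ha hab (-K0 * sat (ω 0 * x a 0)) 0 fun s hs => by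
          rw [ffRhs, if_pos (by simp), hv s hs, kfb_of_modeIdx_eq_zero hR hm, sub_self, abs_zero]
        have hx1 : x b 0 = x a 0 - (b - a) * K0 * sat (ω 0 * x a 0) := by
          rw [zero_mul] at hx0
          have := abs_eq_zero.1 (le_antisymm hx0 (abs_nonneg _))
          linarith
        have hqω : (b - a) * K0 * ω 0 ≤ 1 := by
          have : K0 * ω 0 * (b - a) ≤ K0 * ω 0 * r := by have := hω 0; gcongr
          linarith
        have hdec := sub_mul_sat_abs_le (y := x a 0) (y₀ := y₀ 0) (by positivity) (hω 0) hqω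
        have hk1 : κ₀ * (b - a) ≤ 1 * 1 := by
          gcongr
          · exact min_le_left _ _
          · exact hhr.trans hr0.2
        have hk2 : κ₀ * (b - a) ≤ K0 * min 1 (ω 0 * y₀ 0) * (b - a) := by
          gcongr; exact min_le_right _ _
        refine ⟨one_pos, ?_, fun _ => ?_⟩
        · show (0 : ℝ) ≤ max 1 0 - κ₀ * (b - a)
          linarith [le_max_left (1 : ℝ) 0]
        · show |x b 0| ≤ max (y₀ 0) |x a 0| - κ₀ * (b - a)
          rw [hx1]
          linarith
      | succ j =>
        obtain ⟨h1, h2, h3, -⟩ := hmode j hm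
        exact ⟨h1, h2, h3⟩
    · rw [← Fin.succ_last] at hlast hθ hy hy₀l
      obtain ⟨-, -, -, h4⟩ := hmode (Fin.last n) hlast
      refine h4 hθ ?_
      rw [hy₀l, le_div_iff₀ (hω _)] at hy
      rw [mul_comm]
      exact hy

end Gains

section Progress

/-- The data of a mode reach their thresholds within a uniform time, as long as the mode
persists. -/
lemma exists_mode_time {κ θ y₀ r T₀ : ℝ} (hκ : 0 < κ) (hr : 0 ≤ r) (hT₀ : 0 ≤ T₀) (Y : ℝ → ℝ) :
    ∃ T : ℝ, 0 ≤ T ∧ ∀ (τ : ℕ → ℝ) (a b : ℕ → ℝ) (good : ℕ → Prop), Sched r τ →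
      (∀ k T, τ k ≤ T → a k ≤ Y T ∧ b k ≤ Y T) →
      (∀ k, good k → a (k + 1) ≤ max θ (a k) - κ * (τ (k + 1) - τ k) ∧
        (a k ≤ θ → b (k + 1) ≤ max y₀ (b k) - κ * (τ (k + 1) - τ k))) →
      ∀ k, T ≤ τ k → (∀ m, T₀ ≤ τ m → m ≤ k → good m) → a k ≤ θ ∧ b k ≤ y₀ := by
  set T₁ := T₀ + r + |Y (T₀ + r) - θ| / κ with hT₁
  set T₂ := T₁ + r + |Y (T₁ + r) - y₀| / κ with hT₂
  have hT₁0 : T₀ + r ≤ T₁ := le_add_of_nonneg_right (by positivity)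
  have hT₂0 : T₁ + r ≤ T₂ := le_add_of_nonneg_right (by positivity)
  have key : ∀ {A s c : ℝ}, |A - c| / κ ≤ s → A - κ * s ≤ c := by
    intro A s c h
    rw [div_le_iff₀ hκ] at h
    linarith [le_abs_self (A - c)]
  refine ⟨T₂, by linarith, fun τ a b good hτ hY hstep k hk hgood => ?_⟩
  have hmono := hτ.strictMono.monotone
  obtain ⟨i, hi, hir, hi'⟩ := hτ.exists_first_ge hr hT₀
  have ha : ∀ m, m ≤ k → T₁ ≤ τ m → a m ≤ θ := by
    intro m hmk hm
    have him : i ≤ m := hi' m (by linarith)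
    refine (le_max_of_decay hκ.le hmono him fun q hq hqm =>
      (hstep q (hgood q (hi.trans (hmono hq)) (by omega))).1).trans (max_le le_rfl ?_)
    have h1 := (hY i _ hir).1
    have h2 := key (A := Y (T₀ + r)) (c := θ) (s := τ m - τ i) (by linarith)
    linarith
  refine ⟨ha k le_rfl (by linarith), ?_⟩
  obtain ⟨i₁, hi₁, hi₁r, hi₁'⟩ := hτ.exists_first_ge (T := T₁) hr (by linarith)
  have hik : i₁ ≤ k := hi₁' k (by linarith)
  refine (le_max_of_decay hκ.le hmono hik fun q hq hqm => ?_).trans (max_le le_rfl ?_)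
  · have hq1 : T₁ ≤ τ q := hi₁.trans (hmono hq)
    exact (hstep q (hgood q (by linarith) hqm.le)).2 (ha q hqm.le hq1)
  · have h1 := (hY i₁ _ hi₁r).2
    have h2 := key (A := Y (T₁ + r)) (c := y₀) (s := τ k - τ i₁) (by linarith)
    linarith

/-- A chain of modes, each of which hands over to the next one at its thresholds, reaches the
thresholds of the last mode within a uniform time. -/
lemma exists_last_mode_time {N : ℕ} {r : ℝ} {κ θ y₀ : Fin (N+1) → ℝ} (hκ : ∀ m, 0 < κ m)
    (hr : 0 ≤ r) (Y : ℝ → ℝ) :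
    ∃ T : ℝ, 0 ≤ T ∧ ∀ (τ : ℕ → ℝ) (a b : Fin (N+1) → ℕ → ℝ) (md : ℕ → Fin (N+1)), Sched r τ →
      (∀ m k T, τ k ≤ T → a m k ≤ Y T ∧ b m k ≤ Y T) → Monotone md →
      (∀ m k, md k = m → a m (k + 1) ≤ max (θ m) (a m k) - κ m * (τ (k + 1) - τ k) ∧
        (a m k ≤ θ m → b m (k + 1) ≤ max (y₀ m) (b m k) - κ m * (τ (k + 1) - τ k))) →
      (∀ (j : Fin N) k, a j.castSucc k ≤ θ j.castSucc → b j.castSucc k ≤ y₀ j.castSucc →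
        j.succ ≤ md k) →
      ∀ k, T ≤ τ k → md k = Fin.last N ∧ a (Fin.last N) k ≤ θ (Fin.last N) ∧
        b (Fin.last N) k ≤ y₀ (Fin.last N) := by
  have hreach : ∀ m : Fin (N+1), ∃ T : ℝ, 0 ≤ T ∧ ∀ (τ : ℕ → ℝ) (a b : Fin (N+1) → ℕ → ℝ)
      (md : ℕ → Fin (N+1)), Sched r τ →
      (∀ m k T, τ k ≤ T → a m k ≤ Y T ∧ b m k ≤ Y T) → Monotone md →
      (∀ m k, md k = m → a m (k + 1) ≤ max (θ m) (a m k) - κ m * (τ (k + 1) - τ k) ∧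
        (a m k ≤ θ m → b m (k + 1) ≤ max (y₀ m) (b m k) - κ m * (τ (k + 1) - τ k))) →
      (∀ (j : Fin N) k, a j.castSucc k ≤ θ j.castSucc → b j.castSucc k ≤ y₀ j.castSucc →
        j.succ ≤ md k) → ∀ k, T ≤ τ k → m ≤ md k := by
    intro m
    induction m using Fin.induction with
    | zero => exact ⟨0, le_rfl, fun _ _ _ _ _ _ _ _ _ _ _ => Fin.zero_le _⟩
    | succ j ih =>
      obtain ⟨T₀, hT₀, h₀⟩ := ih
      obtain ⟨T, hT, h⟩ := exists_mode_time (θ := θ j.castSucc) (y₀ := y₀ j.castSucc)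
        (hκ j.castSucc) hr hT₀ Y
      refine ⟨max T T₀, le_max_of_le_left hT, fun τ a b md hτ hY hmd hstep hexit k hk => ?_⟩
      by_contra hlt
      have hle : md k ≤ j.castSucc := Fin.le_castSucc_iff.2 (not_le.1 hlt)
      have := h τ (a j.castSucc) (b j.castSucc) (fun q => md q = j.castSucc) hτ
        (fun k T hk => hY _ k T hk) (fun k hk => hstep _ k hk) k ((le_max_left _ _).trans hk)
        fun q hq hqk => le_antisymm ((hmd hqk).trans hle)
          (h₀ τ a b md hτ hY hmd hstep hexit q hq)
      exact hlt (hexit j k this.1 this.2)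
  obtain ⟨T₀, hT₀, h₀⟩ := hreach (Fin.last N)
  obtain ⟨T, hT, h⟩ := exists_mode_time (θ := θ (Fin.last N)) (y₀ := y₀ (Fin.last N))
    (hκ (Fin.last N)) hr hT₀ Y
  refine ⟨max T T₀, le_max_of_le_left hT, fun τ a b md hτ hY hmd hstep hexit k hk => ?_⟩
  have hlast : ∀ q, T₀ ≤ τ q → md q = Fin.last N := fun q hq =>
    Fin.last_le_iff.1 (h₀ τ a b md hτ hY hmd hstep hexit q hq)
  exact ⟨hlast k ((le_max_right _ _).trans hk), h τ (a (Fin.last N)) (b (Fin.last N))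
    (fun q => md q = Fin.last N) hτ (fun k T hk => hY _ k T hk) (fun k hk => hstep _ k hk) k
    ((le_max_left _ _).trans hk) fun q hq _ => hlast q hq⟩

end Progress

section Sampled

variable {n : ℕ} {P : (j : Fin (n+1)) → Matrix (Fin ((j : ℕ)+1)) (Fin ((j : ℕ)+1)) ℝ}
  {c : (j : Fin (n+1)) → EuclideanSpace ℝ (Fin ((j : ℕ)+1))} {R : Fin (n+1) → ℝ}
  {θ κ y₀ : Fin (n+2) → ℝ} {lam : ℝ}

lemma LoopDecay.modeIdx_le {h : ℝ} {xa xb : EuclideanSpace ℝ (Fin (n+2))}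
    (hd : LoopDecay P c R θ κ y₀ lam h xa xb) : modeIdx P R xa ≤ modeIdx P R xb :=
  le_modeIdx hd.1.1

lemma LoopDecay.atLast {h : ℝ} (hκ : ∀ m, 0 < κ m) (hh : 0 ≤ h)
    {xa xb : EuclideanSpace ℝ (Fin (n+2))} (hd : LoopDecay P c R θ κ y₀ lam h xa xb)
    (ha : AtLast P c R θ y₀ xa) : AtLast P c R θ y₀ xb := by
  have hκh : 0 ≤ κ (Fin.last (n+1)) * h := mul_nonneg (hκ _).le hh
  have hm := hd.modeIdx_le
  obtain ⟨⟨-, h2, h3⟩, -⟩ := hd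
  obtain ⟨e1, e2, e3⟩ := ha
  rw [e1] at hm h2 h3
  rw [max_eq_left e2] at h2
  have h4 := h3 e2
  rw [max_eq_left e3] at h4
  exact ⟨Fin.last_le_iff.1 hm, by linarith, by linarith⟩

lemma lastW_nonneg (hlam : 0 < lam) (x : EuclideanSpace ℝ (Fin (n+2))) : 0 ≤ lastW P c lam x :=
  add_nonneg (abs_nonneg _) (mul_nonneg hlam.le (modeV_nonneg P _ x))

/-- Exponential decay of the samples in the unsaturated region of the last mode. -/
lemma AtLast.decay (hκ : ∀ m, 0 < κ m) (hlam : 0 < lam) {r : ℝ} {τ : ℕ → ℝ} (hτ : Sched r τ)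
    {z : ℕ → EuclideanSpace ℝ (Fin (n+2))}
    (hz : ∀ k, LoopDecay P c R θ κ y₀ lam (τ (k + 1) - τ k) (z k) (z (k + 1))) {i k : ℕ}
    (hik : i ≤ k) (hi : AtLast P c R θ y₀ (z i)) :
    AtLast P c R θ y₀ (z k) ∧ lastW P c lam (z k) ≤
      Real.exp (-(κ (Fin.last (n+1)) * (τ k - τ i))) * lastW P c lam (z i) := by
  have hall : ∀ k, i ≤ k → AtLast P c R θ y₀ (z k) := by
    intro k hk
    induction k, hk using Nat.le_induction with
    | base => exact hi
    | succ k hk ih => exact (hz k).atLast hκ (hτ.2.1 k).le ih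
  exact ⟨hall k hik, le_exp_of_decay (a := fun k => lastW P c lam (z k)) hik
    (fun m => lastW_nonneg hlam _) fun m hm _ => (hz m).2 (hall m hm)⟩

/-- The unsaturated region of the last mode is reached within a uniform time. -/
lemma exists_atLast_time {r : ℝ} (hr : 0 ≤ r) (hκ : ∀ m, 0 < κ m)
    (hnext : ∀ (j : Fin (n+1)) (x : EuclideanSpace ℝ (Fin (n+2))),
      modeV P j.castSucc x ≤ θ j.castSucc →
      |modeY c j.castSucc x| ≤ y₀ j.castSucc → modeV P j.succ x < modeR R j.succ) (Y : ℝ → ℝ) :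
    ∃ T : ℝ, 0 ≤ T ∧ ∀ (τ : ℕ → ℝ) (z : ℕ → EuclideanSpace ℝ (Fin (n+2))), Sched r τ →
      (∀ m k T, τ k ≤ T → modeV P m (z k) ≤ Y T ∧ |modeY c m (z k)| ≤ Y T) →
      (∀ k, LoopDecay P c R θ κ y₀ lam (τ (k + 1) - τ k) (z k) (z (k + 1))) →
      ∀ k, T ≤ τ k → AtLast P c R θ y₀ (z k) := by
  obtain ⟨T, hT, h⟩ := exists_last_mode_time (θ := θ) (y₀ := y₀) hκ hr Y
  refine ⟨T, hT, fun τ z hτ hY hz k hk => ?_⟩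
  refine h τ (fun m k => modeV P m (z k)) (fun m k => |modeY c m (z k)|)
    (fun k => modeIdx P R (z k)) hτ hY (monotone_nat_of_le_succ fun k => (hz k).modeIdx_le)
    (fun m k hm => ?_) (fun j k h1 h2 => le_modeIdx (hnext j (z k) h1 h2)) k hk
  subst hm
  exact (hz k).1.2

end Sampled

section ClosedLoop

/-- Uniform bounds on closed-loop solutions on bounded time intervals, for bounded feedbacks. -/
lemma exists_state_bound {n l : ℕ} {D : Set (EuclideanSpace ℝ (Fin l))}
    {g : Fin (n+1) → EuclideanSpace ℝ (Fin l) → EuclideanSpace ℝ (Fin (n+1)) → ℝ → ℝ}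
    (hg : QuadraticGrowth D g) {k : EuclideanSpace ℝ (Fin (n+1)) → ℝ} {U : ℝ}
    (hk : ∀ x, |k x| ≤ U) (A : ℝ) :
    ∃ Y : ℝ → ℝ, (∀ T, 0 ≤ Y T) ∧ ∀ (r : ℝ) (τ : ℕ → ℝ) (d : ℝ → EuclideanSpace ℝ (Fin l))
      (x : ℝ → EuclideanSpace ℝ (Fin (n+1))), Sched r τ → (∀ t, d t ∈ D) → FFSol g k τ d x →
      ‖x 0‖ ≤ A → ∀ T t : ℝ, 0 ≤ t → t ≤ T → ∀ i, |x t i| ≤ Y T := by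
  have hU : 0 ≤ U := (abs_nonneg _).trans (hk 0)
  choose C hC1 hC using fun T : ℝ => hg.bound_on_interval (n + 1) (T := |T|) (B := max U A)
    (abs_nonneg T) (le_max_of_le_left hU)
  have hS : 0 ≤ max U A := le_max_of_le_left hU
  refine ⟨fun T => C T * max U A, fun T => mul_nonneg (by linarith [hC1 T]) hS, ?_⟩
  intro r τ d x hτ hd hx hA T t ht htT i
  obtain ⟨v, hv, hmv⟩ := hx.exists_input hτ
  refine hC T d x v hd hmv 0 T (max U A) le_rfl (by linarith [le_abs_self T]) hS le_rfl
    (fun s hs => ?_) (fun i _ => ?_) t ⟨ht, htT⟩ i i.isLt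
  · obtain ⟨q, hq⟩ := hτ.exists_mem_Ico hs.1
    rw [hv q s hq]
    exact (hk _).trans (le_max_left _ _)
  · exact ((PiLp.norm_apply_le (x 0) i).trans hA).trans (le_max_right _ _)

variable {n l : ℕ} {D : Set (EuclideanSpace ℝ (Fin l))}
  {g : Fin (n+2) → EuclideanSpace ℝ (Fin l) → EuclideanSpace ℝ (Fin (n+2)) → ℝ → ℝ}
  {P : (j : Fin (n+1)) → Matrix (Fin ((j : ℕ)+1)) (Fin ((j : ℕ)+1)) ℝ}
  {p c : (j : Fin (n+1)) → EuclideanSpace ℝ (Fin ((j : ℕ)+1))} {K0 : ℝ} {ω : Fin (n+2) → ℝ}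
  {K R : Fin (n+1) → ℝ} {θ y₀ : Fin (n+2) → ℝ} {lam : ℝ}

/-- Between samples the state is controlled by the last sample once the last mode is
unsaturated. -/
lemma exists_intersample_bound (hg : QuadraticGrowth D g) (hP : ∀ j, (P j).PosDef)
    (hR : ∀ j, 0 < R j) (hlam : 0 < lam) (r : ℝ) (hr : 0 ≤ r)
    (hθ : ∀ m, 0 < θ m) (hy₀ : ∀ m, 0 < y₀ m) :
    ∃ C : ℝ, 0 ≤ C ∧ ∀ (τ : ℕ → ℝ) (d : ℝ → EuclideanSpace ℝ (Fin l))
      (x : ℝ → EuclideanSpace ℝ (Fin (n+2))), Sched r τ → (∀ t, d t ∈ D) →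
      FFSol g (kfb n K0 ω P p c K R) τ d x → ∀ k, AtLast P c R θ y₀ (x (τ k)) →
      ∀ t ∈ Icc (τ k) (τ (k + 1)), ‖x t‖ ≤ C * lastW P c lam (x (τ k)) := by
  obtain ⟨C₁, hC₁, hcoord⟩ := exists_abs_apply_le hP c
  obtain ⟨C₂, hC₂, hu⟩ := exists_abs_kfb_le (K0 := K0) (ω := ω) (p := p) (c := c) (K := K) hP hR
  have hC₁0 : 0 ≤ C₁ := by linarith
  have hC₂0 : 0 ≤ C₂ := by linarith
  have hθl := hθ (Fin.last (n+1))
  have hyl := hy₀ (Fin.last (n+1))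
  set C₃ := (C₁ + C₂) * (1 + 1 / lam) with hC₃
  have hC₃0 : 0 ≤ C₃ := by positivity
  set M := y₀ (Fin.last (n+1)) + lam * θ (Fin.last (n+1)) with hM
  obtain ⟨C₄, hC₄, hbound⟩ := hg.bound_on_interval (n + 2) (T := r) (B := C₃ * M) hr
    (by positivity)
  have hC₄0 : 0 ≤ C₄ := by linarith
  refine ⟨((n + 2 : ℕ) : ℝ) * (C₄ * C₃), by positivity, ?_⟩
  intro τ d x hτ hd hx k hk t ht
  obtain ⟨v, hv, hmv⟩ := hx.exists_input hτ
  set z := x (τ k) with hz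
  have hV := modeV_nonneg P (Fin.last (n+1)) z
  have hW := lastW_nonneg (P := P) (c := c) hlam z
  have hVW : modeV P (Fin.last (n+1)) z + |modeY c (Fin.last (n+1)) z| ≤
      (1 + 1 / lam) * lastW P c lam z := by
    have h1 : (1 + 1 / lam) * lastW P c lam z = modeV P (Fin.last (n+1)) z +
        |modeY c (Fin.last (n+1)) z| + (lam * modeV P (Fin.last (n+1)) z +
          |modeY c (Fin.last (n+1)) z| / lam) := by
      rw [lastW]; field_simp; ring
    rw [h1]
    exact le_add_of_nonneg_right (by positivity)
  have hS1 : C₁ * (modeV P (Fin.last (n+1)) z + |modeY c (Fin.last (n+1)) z|) ≤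
      C₃ * lastW P c lam z := by
    rw [hC₃, mul_assoc]
    gcongr
    linarith
  have hS2 : C₂ * (modeV P (Fin.last (n+1)) z + |modeY c (Fin.last (n+1)) z|) ≤
      C₃ * lastW P c lam z := by
    rw [hC₃, mul_assoc]
    gcongr
    linarith
  have hWM : lastW P c lam z ≤ M := by
    rw [lastW, hM]
    gcongr
    · exact hk.2.2
    · exact hk.2.1
  rw [mul_assoc, mul_assoc]
  refine norm_le_of_abs_le (by positivity) fun i => ?_
  refine hbound d x v hd hmv (τ k) (τ (k + 1)) _ (hτ.nonneg k) (by linarith [hτ.2.2.1 k])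
    (by positivity) (by gcongr) (fun s hs => ?_) (fun i _ => ?_) t ht i i.isLt
  · rw [hv k s hs]
    refine (hu z).trans (le_trans ?_ hS2)
    rw [hk.1]
    gcongr
    exact min_le_right _ _
  · refine le_trans ?_ hS1
    rcases (Fin.le_last i).lt_or_eq with h | h
    · refine ((hcoord (Fin.last (n+1)) z).1 i h).trans ?_
      gcongr
      exact le_add_of_nonneg_right (abs_nonneg _)
    · rw [h]; exact (hcoord (Fin.last (n+1)) z).2

end ClosedLoop

/-- **Theorem 3.7 (constructive part).** For the feedforward system (1.1) (state dimension
`n+2 ≥ 2`) under the growth assumption (1.2), given arbitrary `K₀ > 0`, `ωᵢ > 0`, symmetric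
positive definite `Pᵢ` and vectors `pᵢ` making `Pᵢ(Aᵢ+bᵢpᵢ') + (Aᵢ'+pᵢbᵢ')Pᵢ` negative
definite, with `cᵢ = -(Aᵢ'+pᵢbᵢ')⁻¹(0,…,0,1)'`, there exist `r > 0` and `Kᵢ, Rᵢ > 0` such
that `0` is RGAS for the closed loop of (1.1) with the feedback (3.19)–(3.21). -/
theorem theorem_3_7_constructive (n l : ℕ)
    (D : Set (EuclideanSpace ℝ (Fin l))) (hD : D.Nonempty) (hDc : IsCompact D)
    (g : Fin (n+2) → EuclideanSpace ℝ (Fin l) → EuclideanSpace ℝ (Fin (n+2)) → ℝ → ℝ)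
    (hgLip : ∀ j : Fin (n+2), LocallyLipschitz
      (fun q : EuclideanSpace ℝ (Fin l) × EuclideanSpace ℝ (Fin (n+2)) × ℝ =>
        g j q.1 q.2.1 q.2.2))
    (hdep : ∀ j : Fin (n+2), ∀ d : EuclideanSpace ℝ (Fin l),
      ∀ x₁ x₂ : EuclideanSpace ℝ (Fin (n+2)), ∀ u : ℝ,
      (∀ m : Fin (n+2), (m : ℕ) < (j : ℕ) → x₁ m = x₂ m) → g j d x₁ u = g j d x₂ u)
    (L : ℝ → ℝ) (hLsmooth : ContDiff ℝ (⊤ : ℕ∞) L) (hLmono : MonotoneOn L (Ici 0))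
    (hLnn : ∀ s : ℝ, 0 ≤ s → 0 ≤ L s)
    (hgrowth : ∀ j : Fin (n+2), (j : ℕ) ≠ 0 → ∀ d ∈ D,
      ∀ x : EuclideanSpace ℝ (Fin (n+2)), ∀ u : ℝ,
      |g j d x u| ≤
        L (Real.sqrt (‖truncV (j : ℕ) x‖ ^ 2 + u ^ 2)) * ‖truncV (j : ℕ) x‖ ^ 2
          + L (Real.sqrt (‖truncV (j : ℕ) x‖ ^ 2 + u ^ 2)) * ‖truncV (j : ℕ) x‖ * |u|)
    (K0 : ℝ) (hK0 : 0 < K0) (ω : Fin (n+2) → ℝ) (hω : ∀ i, 0 < ω i)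
    (P : (j : Fin (n+1)) → Matrix (Fin ((j : ℕ)+1)) (Fin ((j : ℕ)+1)) ℝ)
    (hP : ∀ j, (P j).PosDef)
    (p : (j : Fin (n+1)) → EuclideanSpace ℝ (Fin ((j : ℕ)+1)))
    (hneg : ∀ j : Fin (n+1),
      (-(P j * (matA ((j : ℕ)+1) + vecMulVec (vecbf ((j : ℕ)+1)) (ef (p j)))
          + ((matA ((j : ℕ)+1))ᵀ + vecMulVec (ef (p j)) (vecbf ((j : ℕ)+1))) * P j)).PosDef)
    (c : (j : Fin (n+1)) → EuclideanSpace ℝ (Fin ((j : ℕ)+1)))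
    (hc : ∀ j : Fin (n+1), ef (c j) =
      -((((matA ((j : ℕ)+1))ᵀ + vecMulVec (ef (p j)) (vecbf ((j : ℕ)+1)))⁻¹).mulVec
          (Pi.single (Fin.last (j : ℕ)) 1))) :
    ∃ r : ℝ, 0 < r ∧ ∃ K R : Fin (n+1) → ℝ, (∀ j, 0 < K j) ∧ (∀ j, 0 < R j) ∧
      -- P1: Robust Lagrange Stability
      ((∀ ε : ℝ, 0 < ε → ∃ C : ℝ,
        ∀ (τ : ℕ → ℝ) (d : ℝ → EuclideanSpace ℝ (Fin l))
          (x : ℝ → EuclideanSpace ℝ (Fin (n+2))),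
          Sched r τ → Measurable d → (∀ t : ℝ, d t ∈ D) →
          FFSol g (kfb n K0 ω P p c K R) τ d x →
          ‖x 0‖ ≤ ε → ∀ t : ℝ, 0 ≤ t → ‖x t‖ ≤ C) ∧
      -- P2: Robust Lyapunov Stability
      (∀ ε : ℝ, 0 < ε → ∃ δ0 : ℝ, 0 < δ0 ∧
        ∀ (τ : ℕ → ℝ) (d : ℝ → EuclideanSpace ℝ (Fin l))
          (x : ℝ → EuclideanSpace ℝ (Fin (n+2))),
          Sched r τ → Measurable d → (∀ t : ℝ, d t ∈ D) →
          FFSol g (kfb n K0 ω P p c K R) τ d x →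
          ‖x 0‖ ≤ δ0 → ∀ t : ℝ, 0 ≤ t → ‖x t‖ ≤ ε) ∧
      -- P3: Robust Attractivity
      (∀ ε R0 : ℝ, 0 < ε → 0 ≤ R0 → ∃ T : ℝ, 0 ≤ T ∧
        ∀ (τ : ℕ → ℝ) (d : ℝ → EuclideanSpace ℝ (Fin l))
          (x : ℝ → EuclideanSpace ℝ (Fin (n+2))),
          Sched r τ → Measurable d → (∀ t : ℝ, d t ∈ D) →
          FFSol g (kfb n K0 ω P p c K R) τ d x →
          ‖x 0‖ ≤ R0 → ∀ t : ℝ, T ≤ t → ‖x t‖ ≤ ε)) := by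
  have hg : QuadraticGrowth D g := quadraticGrowth_of_bound hLmono hLnn hgrowth
  obtain ⟨r, hr, K, R, hK, hR, hR1, θ, κ, y₀, lam, hθ, hκ, hy₀, hlam, hnext, hdecay⟩ :=
    exists_gains hg hK0 hω hP hneg hc
  obtain ⟨C₁, hC₁, hVle⟩ := exists_modeV_le hP c
  obtain ⟨C₂, hC₂, hu⟩ := exists_abs_kfb_le (K0 := K0) (ω := ω) (p := p) (c := c) (K := K) hP hR
  obtain ⟨C₃, hC₃, hinter⟩ := exists_intersample_bound (K0 := K0) (ω := ω) (p := p) (c := c)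
    (K := K) hg hP hR hlam r hr.le hθ hy₀
  have hU : ∀ x, |kfb n K0 ω P p c K R x| ≤ C₂ * (1 + 1) := fun x => by
    refine (hu x).trans ?_
    gcongr
    · exact (modeV_modeIdx_lt P R x).le.trans (modeR_le_one hR1 _)
    · exact min_le_left _ _
  choose Y hY0 hY using fun A : ℝ => exists_state_bound hg hU A
  have hsample : ∀ (τ : ℕ → ℝ) (d : ℝ → EuclideanSpace ℝ (Fin l))
      (x : ℝ → EuclideanSpace ℝ (Fin (n+2))), Sched r τ → (∀ t, d t ∈ D) →
      FFSol g (kfb n K0 ω P p c K R) τ d x → ∀ k,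
      LoopDecay P c R θ κ y₀ lam (τ (k + 1) - τ k) (x (τ k)) (x (τ (k + 1))) := by
    intro τ d x hτ hd hx k
    obtain ⟨v, hv, hmv⟩ := hx.exists_input hτ
    exact hdecay d x v hd hmv _ _ (hτ.nonneg k) (by linarith [hτ.2.1 k])
      (by linarith [hτ.2.2.1 k]) (hv k)
  have hP3 : ∀ ε R0 : ℝ, 0 < ε → ∃ T : ℝ, 0 ≤ T ∧
      ∀ (τ : ℕ → ℝ) (d : ℝ → EuclideanSpace ℝ (Fin l)) (x : ℝ → EuclideanSpace ℝ (Fin (n+2))),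
        Sched r τ → (∀ t : ℝ, d t ∈ D) → FFSol g (kfb n K0 ω P p c K R) τ d x →
        ‖x 0‖ ≤ R0 → ∀ t : ℝ, T ≤ t → ‖x t‖ ≤ ε := by
    intro ε R0 hε
    obtain ⟨T, hT, hlast⟩ := exists_atLast_time (P := P) (c := c) (R := R) (lam := lam) hr.le hκ
      hnext (fun T => C₁ * Y R0 T)
    have hκl := hκ (Fin.last (n+1))
    set B := (1 + lam) * (C₁ * Y R0 (T + r)) with hB
    have hB0 : 0 ≤ B := by have := hY0 R0 (T + r); positivity
    refine ⟨T + r + C₃ * B / ε / κ (Fin.last (n+1)) + r, by positivity, ?_⟩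
    intro τ d x hτ hd hx hx0 t ht
    have hz := hsample τ d x hτ hd hx
    have hbd : ∀ m k T, τ k ≤ T → modeV P m (x (τ k)) ≤ C₁ * Y R0 T ∧
        |modeY c m (x (τ k))| ≤ C₁ * Y R0 T := by
      intro m k T hk
      have h1 := hY R0 r τ d x hτ hd hx hx0 T (τ k) (hτ.nonneg k) hk
      obtain ⟨h2, h3⟩ := hVle m (x (τ k)) _ (hY0 R0 T) fun i _ => h1 i
      exact ⟨h2, h3 (h1 m)⟩
    obtain ⟨i, hi, hir, hi'⟩ := hτ.exists_first_ge hr.le hT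
    have hq0 : 0 ≤ C₃ * B / ε / κ (Fin.last (n+1)) := by positivity
    obtain ⟨k, hk⟩ := hτ.exists_mem_Ico (s := t) (by linarith)
    have hkt : T + r + C₃ * B / ε / κ (Fin.last (n+1)) ≤ τ k := by
      linarith [hτ.2.2.1 k, hk.2]
    have hik : i ≤ k := hi' k (by linarith)
    obtain ⟨hAk, hWk⟩ := (hlast τ (fun k => x (τ k)) hτ hbd hz i hi).decay hκ hlam hτ
      (z := fun k => x (τ k)) hz hik
    have hWi : lastW P c lam (x (τ i)) ≤ B := by
      obtain ⟨h1, h2⟩ := hbd (Fin.last (n+1)) i (T + r) hir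
      have h3 := mul_le_mul_of_nonneg_left h1 hlam.le
      rw [lastW, hB]
      linarith
    have hexp : C₃ * B ≤ ε * Real.exp (κ (Fin.last (n+1)) * (τ k - τ i)) := by
      have h1 : C₃ * B / ε ≤ κ (Fin.last (n+1)) * (τ k - τ i) := by
        rw [mul_comm (κ _), ← div_le_iff₀ hκl]
        linarith
      rw [mul_comm ε, ← div_le_iff₀ hε]
      linarith [Real.add_one_le_exp (κ (Fin.last (n+1)) * (τ k - τ i))]
    calc ‖x t‖ ≤ C₃ * lastW P c lam (x (τ k)) := hinter τ d x hτ hd hx k hAk t ⟨hk.1, hk.2.le⟩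
      _ ≤ C₃ * (Real.exp (-(κ (Fin.last (n+1)) * (τ k - τ i))) * B) := by
        gcongr
        refine hWk.trans ?_
        gcongr
      _ = Real.exp (-(κ (Fin.last (n+1)) * (τ k - τ i))) * (C₃ * B) := by ring
      _ ≤ Real.exp (-(κ (Fin.last (n+1)) * (τ k - τ i))) *
          (ε * Real.exp (κ (Fin.last (n+1)) * (τ k - τ i))) := by gcongr
      _ = ε := by
        rw [mul_left_comm, ← Real.exp_add, neg_add_cancel, Real.exp_zero, mul_one]
  refine ⟨r, hr, K, R, hK, hR, ?_, ?_, ?_⟩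
  · intro ε hε
    obtain ⟨T, hT, h⟩ := hP3 1 ε one_pos
    refine ⟨max 1 (((n + 2 : ℕ) : ℝ) * Y ε T), fun τ d x hτ _ hd hx hx0 t ht => ?_⟩
    rcases le_total t T with htT | htT
    · exact le_max_of_le_right (norm_le_of_abs_le (hY0 ε T)
        (hY ε r τ d x hτ hd hx hx0 T t ht htT))
    · exact le_max_of_le_left (h τ d x hτ hd hx hx0 t htT)
  · intro ε hε
    obtain ⟨δ, hδ, hδR, hδθ, hδy, hδε⟩ := ((eventually_pos_le (one_pos (α := ℝ))).and
      ((eventually_mul_le C₁ (half_pos (hR (Fin.last n)))).and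
        ((eventually_mul_le C₁ (hθ (Fin.last (n+1)))).and
          ((eventually_mul_le C₁ (hy₀ (Fin.last (n+1)))).and
            (eventually_mul_le (C₃ * ((1 + lam) * C₁)) hε))))).exists
    refine ⟨δ, hδ.1, fun τ d x hτ _ hd hx hx0 t ht => ?_⟩
    have hcoord : ∀ i, |x 0 i| ≤ δ := fun i => (PiLp.norm_apply_le (x 0) i).trans hx0
    obtain ⟨hV, hY⟩ := hVle (Fin.last (n+1)) (x 0) δ hδ.1.le fun i _ => hcoord i
    have hY := hY (hcoord _)
    have hA : AtLast P c R θ y₀ (x (τ 0)) := by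
      rw [hτ.1]
      refine ⟨Fin.last_le_iff.1 (le_modeIdx ?_), hV.trans hδθ, hY.trans hδy⟩
      have : modeR R (Fin.last (n+1)) = R (Fin.last n) := rfl
      linarith [hR (Fin.last n)]
    obtain ⟨k, hk⟩ := hτ.exists_mem_Ico ht
    obtain ⟨hAk, hWk⟩ := hA.decay hκ hlam hτ (z := fun k => x (τ k))
      (hsample τ d x hτ hd hx) (Nat.zero_le k)
    have hexp : Real.exp (-(κ (Fin.last (n+1)) * (τ k - τ 0))) ≤ 1 := by
      rw [Real.exp_le_one_iff, hτ.1]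
      have := mul_nonneg (hκ (Fin.last (n+1))).le (hτ.nonneg k)
      linarith
    have hW0 : lastW P c lam (x (τ 0)) ≤ (1 + lam) * C₁ * δ := by
      have h3 := mul_le_mul_of_nonneg_left hV hlam.le
      rw [hτ.1, lastW]
      linarith
    calc ‖x t‖ ≤ C₃ * lastW P c lam (x (τ k)) := hinter τ d x hτ hd hx k hAk t ⟨hk.1, hk.2.le⟩
      _ ≤ C₃ * ((1 + lam) * C₁ * δ) := by
        gcongr
        exact (hWk.trans (mul_le_of_le_one_left (lastW_nonneg hlam _) hexp)).trans hW0
      _ ≤ ε := by linarith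
  · intro ε R0 hε _
    obtain ⟨T, hT, h⟩ := hP3 ε R0 hε
    exact ⟨T, hT, fun τ d x hτ _ hd hx hx0 t ht => h τ d x hτ hd hx hx0 t ht⟩
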